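/- arXiv:math/0510666 — 11 statements merged into one kernel-verified Lean document; each statement's English description precedes it below -/
import Mathlib

section
/- Let n ≥ 1 and let v_1, ..., v_{n+1} be unit vectors in R^n. Then the following are equivalent: (i) the vectors v_1, ..., v_{n+1} are not contained in any closed half-space, i.e., there is no nonzero w ∈ R^n with w·v_i ≥ 0 for all i = 1, ..., n+1; (ii) every n of the vectors v_1, ..., v_{n+1} are linearly independent, and the linear system ∑_{i=1}^{n+1} a_i v_i = 0 has a solution (a_1, ..., a_{n+1}) with a_i > 0 for all i = 1, ..., n+1. -/
open RealInnerProductSpace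

/-- If the vectors other than `v i` are linearly independent, then a linear dependence whose `i`-th
coefficient vanishes is trivial. -/
theorem eq_zero_of_sum_smul_eq_zero_of_apply_eq_zero {R M : Type*} [Ring R]
    [AddCommGroup M] [Module R M] {n : ℕ} {v : Fin (n + 1) → M} {a : Fin (n + 1) → R}
    {i : Fin (n + 1)}
    (hv : LinearIndependent R fun j => v (i.succAbove j))
    (ha : ∑ k, a k • v k = 0) (hi : a i = 0) : a = 0 := by
  rw [Fin.sum_univ_succAbove _ i, hi, zero_smul, zero_add] at ha
  funext k
  rcases Fin.eq_self_or_eq_succAbove i k with rfl | ⟨j, rfl⟩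
  · exact hi
  · exact Fintype.linearIndependent_iff.mp hv (fun j => a (i.succAbove j)) ha j

section HalfSpace

variable {E : Type*} [NormedAddCommGroup E] [InnerProductSpace ℝ E] [FiniteDimensional ℝ E]
  {n : ℕ}

/-- Vectors outside every closed half-space span the space even after one is removed. -/
theorem span_succAbove_eq_top_of_forall_not_halfspace {v : Fin (n + 1) → E}
    (h : ∀ w : E, (∀ i, 0 ≤ ⟪w, v i⟫) → w = 0) (i : Fin (n + 1)) :
    Submodule.span ℝ (Set.range fun j => v (i.succAbove j)) = ⊤ := by
  rw [← Submodule.orthogonal_eq_bot_iff, Submodule.eq_bot_iff]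
  intro w hw
  have horth (j : Fin n) : ⟪w, v (i.succAbove j)⟫ = 0 :=
    Submodule.inner_left_of_mem_orthogonal
      (Submodule.subset_span (Set.mem_range_self (f := fun j => v (i.succAbove j)) j)) hw
  rcases le_total 0 ⟪w, v i⟫ with hi | hi
  · refine h w fun k => ?_
    rcases Fin.eq_self_or_eq_succAbove i k with rfl | ⟨j, rfl⟩
    · exact hi
    · exact (horth j).ge
  · refine neg_eq_zero.mp (h (-w) fun k => ?_)
    rw [inner_neg_left, neg_nonneg]
    rcases Fin.eq_self_or_eq_succAbove i k with rfl | ⟨j, rfl⟩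
    · exact hi
    · exact (horth j).le

/-- A linearly independent family has dual vectors with respect to the inner product. -/
theorem LinearIndependent.exists_inner_eq_ite {ι : Type*} [DecidableEq ι] {u : ι → E}
    (hu : LinearIndependent ℝ u) (k : ι) : ∃ w : E, ∀ j, ⟪w, u j⟫ = if j = k then 1 else 0 := by
  obtain ⟨f, hf⟩ := (Module.Basis.span hu).coord k |>.exists_extend
  refine ⟨(InnerProductSpace.toDual ℝ E).symm f.toContinuousLinearMap, fun j => ?_⟩
  have hj := LinearMap.congr_fun hf (Module.Basis.span hu j)
  rw [Module.Basis.coord_apply, Module.Basis.repr_self, LinearMap.comp_apply,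
    Submodule.subtype_apply, Module.Basis.span_apply] at hj
  simpa [Finsupp.single_apply] using hj

/-- For vectors outside every closed half-space, every `n` of which are linearly independent, the
coefficients of a nontrivial linear dependence all have the same sign. -/
theorem mul_pos_of_sum_smul_eq_zero_of_forall_not_halfspace {v : Fin (n + 1) → E}
    (h : ∀ w : E, (∀ i, 0 ≤ ⟪w, v i⟫) → w = 0)
    (hv : ∀ i : Fin (n + 1), LinearIndependent ℝ fun j => v (i.succAbove j))
    {a : Fin (n + 1) → ℝ} (ha : ∑ k, a k • v k = 0) (ha0 : a ≠ 0) (p q : Fin (n + 1)) :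
    0 < a p * a q := by
  have hne (i) : a i ≠ 0 := fun hi =>
    ha0 (eq_zero_of_sum_smul_eq_zero_of_apply_eq_zero (hv i) ha hi)
  rcases Fin.eq_self_or_eq_succAbove p q with rfl | ⟨k, rfl⟩
  · exact mul_self_pos.mpr (hne _)
  by_contra hneg
  obtain ⟨w, hw⟩ := (hv p).exists_inner_eq_ite k
  have hsum : a p * ⟪w, v p⟫ + a (p.succAbove k) = 0 := by
    have := congrArg (fun x => ⟪w, x⟫) ha
    simpa [inner_add_right, inner_sum, inner_smul_right, Fin.sum_univ_succAbove _ p, hw] using this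
  have hp : 0 ≤ ⟪w, v p⟫ := by
    have hsq : 0 < a p * a p := mul_self_pos.mpr (hne p)
    have hmul : a p * a p * ⟪w, v p⟫ = -(a p * a (p.succAbove k)) := by
      linear_combination a p * hsum
    exact nonneg_of_mul_nonneg_right (by linarith) hsq
  have hw0 : w = 0 := by
    refine h w fun i => ?_
    rcases Fin.eq_self_or_eq_succAbove p i with rfl | ⟨j, rfl⟩
    · exact hp
    · rw [hw]
      split_ifs <;> norm_num
  simpa [hw0] using hw k

end HalfSpace

/-- Lemma 4, (4.1) ⟺ (4.2): unit vectors `v 1, ..., v (n+1)` in `ℝ^n` are not contained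
in any closed half-space iff every `n` of them are linearly independent and there is a
strictly positive linear dependence among them. -/
theorem not_in_closed_halfspace_iff_indep_and_pos_dependence
    (n : ℕ) (hn : 1 ≤ n) (v : Fin (n + 1) → EuclideanSpace ℝ (Fin n))
    (hunit : ∀ i, ‖v i‖ = 1) :
    (¬ ∃ w : EuclideanSpace ℝ (Fin n), w ≠ 0 ∧ ∀ i, 0 ≤ ⟪w, v i⟫) ↔
      ((∀ i : Fin (n + 1), LinearIndependent ℝ (fun j : Fin n => v (i.succAbove j))) ∧
        ∃ a : Fin (n + 1) → ℝ, (∀ i, 0 < a i) ∧ ∑ i, a i • v i = 0) := by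
  constructor
  · intro hnot
    have h (w : EuclideanSpace ℝ (Fin n)) (hw : ∀ i, 0 ≤ ⟪w, v i⟫) : w = 0 :=
      by_contra fun hw0 => hnot ⟨w, hw0, hw⟩
    have hv (i : Fin (n + 1)) : LinearIndependent ℝ (fun j : Fin n => v (i.succAbove j)) :=
      linearIndependent_of_top_le_span_of_card_eq_finrank
        (span_succAbove_eq_top_of_forall_not_halfspace h i).ge (by simp)
    have hdep : ¬ LinearIndependent ℝ v := fun hli => by
      simpa using hli.fintype_card_le_finrank
    obtain ⟨a, ha, i, hi⟩ := Fintype.not_linearIndependent_iff.mp hdep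
    refine ⟨hv, fun k => a 0 * a k, fun k =>
      mul_pos_of_sum_smul_eq_zero_of_forall_not_halfspace h hv ha
        (fun h0 => hi (congrFun h0 i)) 0 k, ?_⟩
    simp only [mul_smul, ← Finset.smul_sum, ha, smul_zero]
  · rintro ⟨hv, a, hpos, ha⟩ ⟨w, hw0, hw⟩
    have hsum : ∑ i, a i * ⟪w, v i⟫ = 0 := by
      simpa [inner_sum, inner_smul_right] using congrArg (fun x => ⟪w, x⟫) ha
    have hzero (i : Fin (n + 1)) : ⟪w, v i⟫ = 0 := by
      have hi := (Finset.sum_eq_zero_iff_of_nonneg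
        fun i _ => mul_nonneg (hpos i).le (hw i)).mp hsum i (Finset.mem_univ i)
      exact (mul_eq_zero.mp hi).resolve_left (hpos i).ne'
    have hspan := (hv 0).span_eq_top_of_card_eq_finrank' (by simp)
    refine hw0 (inner_self_eq_zero (𝕜 := ℝ).mp ?_)
    have hle : Submodule.span ℝ (Set.range fun j => v ((0 : Fin (n + 1)).succAbove j)) ≤
        (ℝ ∙ w)ᗮ := by
      rw [Submodule.span_le]
      rintro _ ⟨j, rfl⟩
      exact Submodule.mem_orthogonal_singleton_iff_inner_right.mpr (hzero _)
    rw [hspan] at hle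
    exact Submodule.mem_orthogonal_singleton_iff_inner_right.mp (hle Submodule.mem_top)
end

section
/- Let n ≥ 1. Let E_{n+1} ⊂ (R^n)^{n+1} be the set of tuples (v_1, ..., v_{n+1}) of unit vectors in R^n such that every n of the vectors are linearly independent and ∑_{i=1}^{n+1} a_i v_i = 0 has a solution with all a_i > 0. Then the closure of E_{n+1} in (R^n)^{n+1} is exactly the set of tuples (v_1, ..., v_{n+1}) of unit vectors in R^n such that ∑_{i=1}^{n+1} a_i v_i = 0 has a nonzero solution (a_1, ..., a_{n+1}) with all a_i ≥ 0. -/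
open RealInnerProductSpace

open Filter Topology

/-- If `n` of `n + 1` vectors in an `n`-dimensional space are independent and the vectors satisfy
a linear relation with all coefficients nonzero, then any `n` of them are independent. -/
theorem linearIndependent_succAbove_of_relation {K V : Type*} [Field K] [AddCommGroup V]
    [Module K V] [FiniteDimensional K V] {n : ℕ} (hfin : Module.finrank K V = n)
    {w : Fin (n + 1) → V} {b : Fin (n + 1) → K}
    (hb : ∀ i, b i ≠ 0) (hsum : ∑ i, b i • w i = 0) (k : Fin (n + 1))
    (hk : LinearIndependent K (fun j => w (k.succAbove j))) (i : Fin (n + 1)) :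
    LinearIndependent K (fun j => w (i.succAbove j)) := by
  have hmem : ∀ j, w (i.succAbove j) ∈ Submodule.span K (Set.range fun j => w (i.succAbove j)) :=
    fun j => Submodule.subset_span ⟨j, rfl⟩
  have hmem_i : w i ∈ Submodule.span K (Set.range fun j => w (i.succAbove j)) := by
    rw [Fin.sum_univ_succAbove _ i] at hsum
    rw [← Submodule.smul_mem_iff _ (hb i), eq_neg_of_add_eq_zero_left hsum]
    exact neg_mem (Submodule.sum_mem _ fun j _ => Submodule.smul_mem _ _ (hmem j))
  refine linearIndependent_of_top_le_span_of_card_eq_finrank ?_ (by simp [hfin])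
  rw [← hk.span_eq_top_of_card_eq_finrank' (by simp [hfin]), Submodule.span_le]
  rintro _ ⟨j, rfl⟩
  rcases Fin.eq_self_or_eq_succAbove i (k.succAbove j) with h | ⟨l, h⟩
  · simpa only [h, SetLike.mem_coe] using hmem_i
  · simpa only [h, SetLike.mem_coe] using hmem l

/-- Translating a family of vectors by a small multiple of a basis makes it independent. -/
theorem Module.Basis.eventually_linearIndependent_add_smul {ι V : Type*} [Finite ι]
    [AddCommGroup V] [Module ℝ V] (e : Module.Basis ι ℝ V) (v : ι → V) :
    ∀ᶠ t : ℝ in 𝓝[>] 0, LinearIndependent ℝ (fun j => v j + t • e j) := by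
  have : FiniteDimensional ℝ V := e.finiteDimensional_of_finite
  set L : Module.End ℝ V := e.constr ℝ v with hL
  have hfin : {t : ℝ | L.HasEigenvalue (-t)}.Finite :=
    (Module.End.finite_hasEigenvalue L).preimage neg_injective.injOn
  have hev : ∀ᶠ t : ℝ in 𝓝[≠] 0, ¬ L.HasEigenvalue (-t) :=
    nhdsNE_le_cofinite 0 hfin.compl_mem_cofinite
  filter_upwards [hev.filter_mono (nhdsWithin_mono _ fun t ht => ne_of_gt ht)] with t ht
  have hker : LinearMap.ker (L + t • LinearMap.id) = ⊥ := by
    rw [Module.End.hasEigenvalue_iff, not_not, Module.End.eigenspace_def] at ht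
    rw [← ht]
    congr 1
    ext x
    simp
  simpa [Function.comp_def, hL] using e.linearIndependent.map' _ hker

/-- Tuples of unit vectors with a nontrivial nonnegative linear relation form a closed set. -/
theorem isClosed_unit_nonneg_relation {ι V : Type*} [Fintype ι] [NormedAddCommGroup V]
    [NormedSpace ℝ V] :
    IsClosed {v : ι → V | (∀ i, ‖v i‖ = 1) ∧
      ∃ a : ι → ℝ, a ≠ 0 ∧ (∀ i, 0 ≤ a i) ∧ ∑ i, a i • v i = 0} := by
  have hunit : IsClosed {v : ι → V | ∀ i, ‖v i‖ = 1} := by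
    simp only [Set.ofPred_forall]
    exact isClosed_iInter fun i => isClosed_eq (by fun_prop) continuous_const
  have : CompactSpace (stdSimplex ℝ ι) := isCompact_iff_compactSpace.1 (isCompact_stdSimplex ℝ ι)
  have hrel : IsClosed {p : stdSimplex ℝ ι × (ι → V) | ∑ i, p.1.1 i • p.2 i = 0} :=
    isClosed_eq (continuous_finsetSum _ fun i _ =>
      ((continuous_apply i).comp (continuous_subtype_val.comp continuous_fst)).smul
        ((continuous_apply i).comp continuous_snd)) continuous_const
  convert hunit.inter (isClosedMap_snd_of_compactSpace _ hrel) using 1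
  ext v
  refine and_congr_right fun _ => ⟨?_, ?_⟩
  · rintro ⟨a, ha, hnonneg, hsum⟩
    have hpos : 0 < ∑ i, a i := by
      obtain ⟨k, hk⟩ := Function.ne_iff.1 ha
      exact Finset.sum_pos' (fun i _ => hnonneg i)
        ⟨k, Finset.mem_univ k, (hnonneg k).lt_of_ne' hk⟩
    refine ⟨(⟨fun i => (∑ j, a j)⁻¹ * a i, fun i => by have := hnonneg i; positivity, ?_⟩, v),
      ?_, rfl⟩
    · rw [← Finset.mul_sum, inv_mul_cancel₀ hpos.ne']
    · simp only [Set.mem_ofPred_eq, mul_smul, ← Finset.smul_sum, hsum, smul_zero]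
  · rintro ⟨⟨⟨a, hnonneg, hone⟩, _⟩, hsum, rfl⟩
    refine ⟨a, ?_, hnonneg, hsum⟩
    rintro rfl
    simp at hone

/-- Lemma 5: the closure in `(ℝ^n)^{n+1}` of the set `E_{n+1}` of tuples of unit outward
normal vectors of Euclidean `n`-simplexes (characterized by condition (4.2) of Lemma 4)
is exactly the set of tuples of unit vectors admitting a nonzero nonnegative linear
dependence (condition (5.2)). -/
theorem closure_euclidean_normals
    (n : ℕ) (hn : 1 ≤ n) :
    closure {v : Fin (n + 1) → EuclideanSpace ℝ (Fin n) |
        (∀ i, ‖v i‖ = 1) ∧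
        (∀ i : Fin (n + 1), LinearIndependent ℝ (fun j : Fin n => v (i.succAbove j))) ∧
        ∃ a : Fin (n + 1) → ℝ, (∀ i, 0 < a i) ∧ ∑ i, a i • v i = 0} =
      {v : Fin (n + 1) → EuclideanSpace ℝ (Fin n) |
        (∀ i, ‖v i‖ = 1) ∧
        ∃ a : Fin (n + 1) → ℝ, a ≠ 0 ∧ (∀ i, 0 ≤ a i) ∧ ∑ i, a i • v i = 0} := by
  refine (closure_minimal ?_ isClosed_unit_nonneg_relation).antisymm ?_
  · rintro v ⟨hunit, -, a, ha, hsum⟩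
    exact ⟨hunit, a, fun h => (ha 0).ne' (congrFun h 0), fun i => (ha i).le, hsum⟩
  rintro v ⟨hunit, a, ha, hnonneg, hsum⟩
  obtain ⟨k, hk⟩ := Function.ne_iff.1 ha
  replace hk : 0 < a k := (hnonneg k).lt_of_ne' hk
  -- Perturb the vectors other than `v k` to a basis, and solve the perturbed relation for `w t k`.
  let e := (EuclideanSpace.basisFun (Fin n) ℝ).toBasis
  let u : ℝ → Fin n → EuclideanSpace ℝ (Fin n) := fun t j => v (k.succAbove j) + t • e j
  let w : ℝ → Fin (n + 1) → EuclideanSpace ℝ (Fin n) := fun t =>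
    k.insertNth (-((a k)⁻¹ • ∑ j, (a (k.succAbove j) + t) • u t j)) (u t)
  have hw_k : ∀ t, w t k = -((a k)⁻¹ • ∑ j, (a (k.succAbove j) + t) • u t j) := fun t => by
    simp [w]
  have hw_succAbove : ∀ t j, w t (k.succAbove j) = u t j := fun t j => by simp [w]
  have hw_zero : w 0 = v := by
    funext i
    rcases Fin.eq_self_or_eq_succAbove k i with rfl | ⟨j, rfl⟩
    · rw [Fin.sum_univ_succAbove _ i] at hsum
      simp only [hw_k, u, zero_smul, add_zero]
      rw [eq_neg_of_add_eq_zero_right hsum, smul_neg, neg_neg, smul_smul, inv_mul_cancel₀ hk.ne',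
        one_smul]
    · simp [hw_succAbove, u]
  have hw_cont : Continuous w := by
    refine continuous_pi fun i => ?_
    rcases Fin.eq_self_or_eq_succAbove k i with rfl | ⟨j, rfl⟩
    · simp only [hw_k, u]
      fun_prop
    · simp only [hw_succAbove, u]
      fun_prop
  have hw_lim : ∀ i, Tendsto (fun t => w t i) (𝓝[>] 0) (𝓝 (v i)) := fun i => by
    have h := (((continuous_apply i).comp hw_cont).tendsto 0).mono_left
      (nhdsWithin_le_nhds (s := Set.Ioi 0))
    simpa [Function.comp_def, hw_zero] using h
  have hv_ne : ∀ i, v i ≠ 0 := fun i h => by simpa [h] using hunit i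
  have hw_ne : ∀ᶠ t in 𝓝[>] (0 : ℝ), ∀ i, w t i ≠ 0 :=
    eventually_all.2 fun i => (hw_lim i).eventually_ne (hv_ne i)
  refine mem_closure_of_tendsto (f := fun t i => ‖w t i‖⁻¹ • w t i) (b := 𝓝[>] (0 : ℝ)) ?_ ?_
  · refine tendsto_pi_nhds.2 fun i => ?_
    simpa [hunit i] using ((hw_lim i).norm.inv₀ (norm_ne_zero_iff.2 (hv_ne i))).smul (hw_lim i)
  filter_upwards [hw_ne, self_mem_nhdsWithin,
    e.eventually_linearIndependent_add_smul fun j => v (k.succAbove j)] with t hne ht hind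
  replace ht : 0 < t := ht
  let b : Fin (n + 1) → ℝ := k.insertNth (a k) fun j => a (k.succAbove j) + t
  have hb_pos : ∀ i, 0 < b i := fun i => by
    rcases Fin.eq_self_or_eq_succAbove k i with rfl | ⟨j, rfl⟩
    · simpa [b] using hk
    · simpa [b] using add_pos_of_nonneg_of_pos (hnonneg _) ht
  have hb_sum : ∑ i, b i • w t i = 0 := by
    rw [Fin.sum_univ_succAbove _ k]
    simp [b, hw_k, hw_succAbove, smul_smul, mul_inv_cancel₀ hk.ne']
  have hnorm : ∀ i, 0 < ‖w t i‖ := fun i => norm_pos_iff.2 (hne i)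
  refine ⟨fun i => norm_smul_inv_norm (𝕜 := ℝ) (hne i), fun i => ?_,
    fun i => b i * ‖w t i‖, fun i => mul_pos (hb_pos i) (hnorm i), ?_⟩
  · have hi := linearIndependent_succAbove_of_relation (by simp) (fun i => (hb_pos i).ne') hb_sum k
      (by simpa only [hw_succAbove] using hind) i
    exact hi.units_smul fun j => Units.mk0 _ (inv_ne_zero (hnorm (i.succAbove j)).ne')
  · simpa [smul_smul, mul_assoc, (hnorm _).ne'] using hb_sum
end

section
/- Let n ≥ 1. Let Z_{n+1} be the set of (n+1)×(n+1) real matrices of the form [v_i·v_j]_{1≤i,j≤n+1} where (v_1, ..., v_{n+1}) is a tuple of unit vectors in R^n such that every n of the vectors are linearly independent and ∑_{i=1}^{n+1} a_i v_i = 0 has a solution with all a_i > 0. Then the closure of Z_{n+1} in the space of (n+1)×(n+1) real matrices is exactly the set of matrices of the form [v_i·v_j]_{1≤i,j≤n+1} where (v_1, ..., v_{n+1}) is a tuple of unit vectors in R^n such that ∑_{i=1}^{n+1} a_i v_i = 0 has a nonzero solution with all a_i ≥ 0. -/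
open RealInnerProductSpace

open Filter Topology NormedSpace

/-- The Gram matrices of tuples of `n + 1` unit vectors in `ℝⁿ`, any `n` of which are linearly
independent, that admit a linear dependence with positive coefficients. -/
def simplexGramMatrices (n : ℕ) : Set (Matrix (Fin (n + 1)) (Fin (n + 1)) ℝ) :=
  {A | ∃ v : Fin (n + 1) → EuclideanSpace ℝ (Fin n),
      (∀ i, ‖v i‖ = 1) ∧
      (∀ i : Fin (n + 1), LinearIndependent ℝ (fun j : Fin n => v (i.succAbove j))) ∧
      (∃ a : Fin (n + 1) → ℝ, (∀ i, 0 < a i) ∧ ∑ i, a i • v i = 0) ∧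
      A = Matrix.of (fun i j => ⟪v i, v j⟫)}

/-- The Gram matrices of tuples of `n + 1` unit vectors in `ℝⁿ` that admit a nonzero linear
dependence with nonnegative coefficients. -/
def degenerateSimplexGramMatrices (n : ℕ) : Set (Matrix (Fin (n + 1)) (Fin (n + 1)) ℝ) :=
  {A | ∃ v : Fin (n + 1) → EuclideanSpace ℝ (Fin n),
      (∀ i, ‖v i‖ = 1) ∧
      (∃ a : Fin (n + 1) → ℝ, a ≠ 0 ∧ (∀ i, 0 ≤ a i) ∧ ∑ i, a i • v i = 0) ∧
      A = Matrix.of (fun i j => ⟪v i, v j⟫)}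

/-- The Gram matrix of the unit vectors in the directions of a tuple of vectors. -/
noncomputable def directionGram {ι E : Type*} [NormedAddCommGroup E] [InnerProductSpace ℝ E]
    (u : ι → E) : Matrix ι ι ℝ :=
  Matrix.of fun i j => ⟪normalize (u i), normalize (u j)⟫

theorem tendsto_directionGram {ι E X : Type*} [NormedAddCommGroup E] [InnerProductSpace ℝ E]
    {l : Filter X} {u : X → ι → E} {w : ι → E} (hu : Tendsto u l (𝓝 w)) (hw : ∀ i, w i ≠ 0) :
    Tendsto (fun x => directionGram (u x)) l (𝓝 (directionGram w)) := by
  have key : ∀ i, Tendsto (fun x => normalize (u x i)) l (𝓝 (normalize (w i))) := fun i => by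
    have hi : Tendsto (fun x => u x i) l (𝓝 (w i)) := tendsto_pi_nhds.1 hu i
    exact (hi.norm.inv₀ (norm_ne_zero_iff.2 (hw i))).smul hi
  exact tendsto_pi_nhds.2 fun i => tendsto_pi_nhds.2 fun j => (key i).inner (key j)

theorem directionGram_smul {ι E : Type*} [NormedAddCommGroup E] [InnerProductSpace ℝ E]
    {b : ι → ℝ} (hb : ∀ i, 0 < b i) (u : ι → E) :
    directionGram (fun i => b i • u i) = directionGram u := by
  ext i j
  simp [directionGram, normalize_smul_of_pos (hb _)]

theorem directionGram_of_norm_eq_one {ι E : Type*} [NormedAddCommGroup E] [InnerProductSpace ℝ E]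
    {u : ι → E} (hu : ∀ i, ‖u i‖ = 1) :
    directionGram u = Matrix.of fun i j => ⟪u i, u j⟫ := by
  ext i j
  simp [directionGram, normalize_eq_self_of_norm_eq_one (hu _)]

/-- If `n + 1` vectors of an `n`-dimensional space sum to zero and the first `n` of them are
linearly independent, then any `n` of them are. -/
theorem linearIndependent_succAbove_of_sum_eq_zero {K V : Type*} [Field K] [AddCommGroup V]
    [Module K V] [FiniteDimensional K V] {n : ℕ} (hV : Module.finrank K V = n)
    {u : Fin (n + 1) → V} (hsum : ∑ i, u i = 0)
    (hu : LinearIndependent K fun j : Fin n => u j.castSucc) (i : Fin (n + 1)) :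
    LinearIndependent K fun j : Fin n => u (i.succAbove j) := by
  refine linearIndependent_of_top_le_span_of_card_eq_finrank ?_ (by simp [hV])
  rw [← hu.span_eq_top_of_card_eq_finrank' (by simp [hV]), Submodule.span_le]
  rintro _ ⟨j, rfl⟩
  have hmem : ∀ k, u (i.succAbove k) ∈
      Submodule.span K (Set.range fun j : Fin n => u (i.succAbove j)) := fun k =>
    Submodule.subset_span ⟨k, rfl⟩
  rcases Fin.eq_self_or_eq_succAbove i j.castSucc with h | ⟨k, h⟩
  · rw [Fin.sum_univ_succAbove _ i] at hsum
    simp only [SetLike.mem_coe, h, eq_neg_of_add_eq_zero_left hsum]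
    exact Submodule.neg_mem _ (Submodule.sum_mem _ fun k _ => hmem k)
  · simpa only [SetLike.mem_coe, h] using hmem k

theorem directionGram_mem_simplexGramMatrices {n : ℕ}
    {u : Fin (n + 1) → EuclideanSpace ℝ (Fin n)} (hne : ∀ i, u i ≠ 0) (hsum : ∑ i, u i = 0)
    (hu : LinearIndependent ℝ fun j : Fin n => u j.castSucc) :
    directionGram u ∈ simplexGramMatrices n := by
  refine ⟨fun i => normalize (u i), fun i => norm_normalize (hne i), fun i => ?_,
    ⟨fun i => ‖u i‖, fun i => norm_pos_iff.2 (hne i), by simpa using hsum⟩, rfl⟩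
  exact (linearIndependent_succAbove_of_sum_eq_zero (by simp) hsum hu i).units_smul
    fun j => (Units.mk0 ‖u (i.succAbove j)‖ (norm_ne_zero_iff.2 (hne _)))⁻¹

theorem eventually_linearIndependent_add_smul_single {n : ℕ}
    (u : Fin n → EuclideanSpace ℝ (Fin n)) :
    ∀ᶠ t : ℝ in 𝓝[≠] 0,
      LinearIndependent ℝ fun j => u j + t • EuclideanSpace.single j (1 : ℝ) := by
  set M : Matrix (Fin n) (Fin n) ℝ := Matrix.of fun i j => u i j with hM
  have hroots : ∀ᶠ t : ℝ in 𝓝[≠] 0, t ∉ {t | (-M).charpoly.IsRoot t} :=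
    nhdsNE_le_cofinite 0
      (Polynomial.finite_setOfPred_isRoot (-M).charpoly_monic.ne_zero).eventually_cofinite_notMem
  filter_upwards [hroots] with t ht
  have hunit : IsUnit (Matrix.scalar (Fin n) t - -M) := by
    rw [Matrix.isUnit_iff_isUnit_det, isUnit_iff_ne_zero, ← Matrix.eval_charpoly]
    exact ht
  have hrow := (Matrix.linearIndependent_rows_iff_isUnit.2 hunit).map'
    (WithLp.linearEquiv 2 ℝ (Fin n → ℝ)).symm.toLinearMap (LinearEquiv.ker _)
  have heq : (fun j => u j + t • EuclideanSpace.single j (1 : ℝ)) =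
      (WithLp.linearEquiv 2 ℝ (Fin n → ℝ)).symm.toLinearMap ∘
        (Matrix.scalar (Fin n) t - -M).row := by
    ext i j
    change _ = (Matrix.scalar (Fin n) t - -M) i j
    simp [hM, Matrix.diagonal_apply, add_comm, eq_comm]
  rw [heq]
  exact hrow

/-- Nonzero vectors with zero sum can be perturbed into general position. -/
theorem directionGram_mem_closure {n : ℕ} {u : Fin (n + 1) → EuclideanSpace ℝ (Fin n)}
    (hne : ∀ i, u i ≠ 0) (hsum : ∑ i, u i = 0) :
    directionGram u ∈ closure (simplexGramMatrices n) := by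
  let d : Fin (n + 1) → EuclideanSpace ℝ (Fin n) :=
    Fin.snoc (fun j => EuclideanSpace.single j (1 : ℝ)) (-∑ j, EuclideanSpace.single j (1 : ℝ))
  have hd : ∑ i, d i = 0 := by simp [d, Fin.sum_univ_castSucc]
  have hlim : Tendsto (fun t : ℝ => u + t • d) (𝓝[≠] 0) (𝓝 u) := by
    have : Continuous fun t : ℝ => u + t • d := by fun_prop
    simpa using (this.tendsto 0).mono_left nhdsWithin_le_nhds
  refine mem_closure_of_tendsto (tendsto_directionGram hlim hne) ?_
  have hev : ∀ᶠ t : ℝ in 𝓝[≠] 0, ∀ i, (u + t • d) i ≠ 0 :=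
    eventually_all.2 fun i => (tendsto_pi_nhds.1 hlim i).eventually_ne (hne i)
  filter_upwards [hev, eventually_linearIndependent_add_smul_single fun j => u j.castSucc]
    with t ht hind
  refine directionGram_mem_simplexGramMatrices ht ?_ ?_
  · simp [Finset.sum_add_distrib, hsum, ← Finset.smul_sum, hd]
  · simpa [d] using hind

theorem degenerateSimplexGramMatrices_subset_closure (n : ℕ) :
    degenerateSimplexGramMatrices n ⊆ closure (simplexGramMatrices n) := by
  classical
  rintro A ⟨v, hv, ⟨a, ha, hnonneg, hsum⟩, rfl⟩
  have hv0 : ∀ i, v i ≠ 0 := fun i => norm_ne_zero_iff.1 (by simp [hv i])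
  let I : Finset (Fin (n + 1)) := {i | a i ≠ 0}
  have hI : (I.card : ℝ) ≠ 0 := by
    obtain ⟨i, hi⟩ := Function.ne_iff.1 ha
    exact Nat.cast_ne_zero.2 (Finset.card_ne_zero_of_mem (a := i) (by simpa [I] using hi))
  -- The vectors outside the support get weight `t`; the supported ones absorb the defect.
  let w := (I.card : ℝ)⁻¹ • ∑ i ∈ Iᶜ, v i
  let u : ℝ → Fin (n + 1) → EuclideanSpace ℝ (Fin n) := fun t i =>
    if a i ≠ 0 then a i • v i - t • w else v i
  let b : ℝ → Fin (n + 1) → ℝ := fun t i => if a i ≠ 0 then 1 else t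
  have hbpos : ∀ t, 0 < t → ∀ i, 0 < b t i := fun t ht i => by
    by_cases hi : a i = 0 <;> simp [b, hi, ht]
  have hu0 : directionGram (u 0) = Matrix.of fun i j => ⟪v i, v j⟫ := by
    rw [← directionGram_of_norm_eq_one hv, ← directionGram_smul
      (b := fun i => if a i ≠ 0 then a i else 1) (fun i => ?_) v]
    · congr 1
      ext1 i
      by_cases hi : a i = 0 <;> simp [u, hi]
    · by_cases hi : a i = 0
      · simp [hi]
      · simpa [hi] using (hnonneg i).lt_of_ne' hi
  have hne0 : ∀ i, u 0 i ≠ 0 := fun i => by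
    by_cases hi : a i = 0 <;> simp [u, hi, hv0]
  have hlim : Tendsto u (𝓝[>] 0) (𝓝 (u 0)) := by
    have : Continuous u := continuous_pi fun i => by
      by_cases hi : a i = 0
      · simp only [u, hi, ne_eq, not_true_eq_false, if_false]
        fun_prop
      · simp only [u, hi, ne_eq, not_false_eq_true, if_true]
        fun_prop
    exact (this.tendsto 0).mono_left nhdsWithin_le_nhds
  have hsumu : ∀ t, ∑ i, b t i • u t i = 0 := fun t => by
    have hterm : ∀ i, b t i • u t i = a i • v i +
        ((if i ∈ I then -(t • w) else 0) + if i ∈ Iᶜ then t • v i else 0) := fun i => by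
      by_cases hi : a i = 0 <;> simp [b, u, I, hi, sub_eq_add_neg]
    rw [Finset.sum_congr rfl fun i _ => hterm i, Finset.sum_add_distrib, hsum,
      Finset.sum_add_distrib, Finset.sum_ite_mem, Finset.sum_ite_mem, Finset.univ_inter,
      Finset.univ_inter, Finset.sum_const, ← Finset.smul_sum, ← Nat.cast_smul_eq_nsmul ℝ]
    simp only [w, smul_neg, smul_comm _ t, smul_inv_smul₀ hI]
    simp
  rw [← hu0, ← closure_closure]
  refine mem_closure_of_tendsto (tendsto_directionGram hlim hne0) ?_
  have hev : ∀ᶠ t : ℝ in 𝓝[>] 0, ∀ i, u t i ≠ 0 :=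
    eventually_all.2 fun i => (tendsto_pi_nhds.1 hlim i).eventually_ne (hne0 i)
  filter_upwards [hev, self_mem_nhdsWithin] with t hut ht
  rw [← directionGram_smul (hbpos t ht)]
  exact directionGram_mem_closure
    (fun i => smul_ne_zero (hbpos t ht i).ne' (hut i)) (hsumu t)

theorem isClosed_degenerateSimplexGramMatrices (n : ℕ) :
    IsClosed (degenerateSimplexGramMatrices n) := by
  let S : Set ((Fin (n + 1) → EuclideanSpace ℝ (Fin n)) × (Fin (n + 1) → ℝ)) :=
    (Set.univ.pi fun _ => Metric.sphere 0 1) ×ˢ stdSimplex ℝ (Fin (n + 1))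
  have hS : IsCompact S :=
    (isCompact_univ_pi fun _ => isCompact_sphere _ _).prod (isCompact_stdSimplex ℝ _)
  have hclosed : IsClosed {p : (Fin (n + 1) → EuclideanSpace ℝ (Fin n)) × (Fin (n + 1) → ℝ) |
      ∑ i, p.2 i • p.1 i = 0} := isClosed_eq (by fun_prop) continuous_const
  have hcont : Continuous fun p : (Fin (n + 1) → EuclideanSpace ℝ (Fin n)) ×
      (Fin (n + 1) → ℝ) => (Matrix.of fun i j => ⟪p.1 i, p.1 j⟫ :
        Matrix (Fin (n + 1)) (Fin (n + 1)) ℝ) :=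
    continuous_matrix fun i j => by simp only [Matrix.of_apply]; fun_prop
  convert ((hS.inter_right hclosed).image hcont).isClosed using 1
  ext A
  constructor
  · rintro ⟨v, hv, ⟨a, ha, hnonneg, hsum⟩, rfl⟩
    have hpos : 0 < ∑ i, a i := by
      obtain ⟨i, hi⟩ := Function.ne_iff.1 ha
      exact Finset.sum_pos' (fun i _ => hnonneg i)
        ⟨i, Finset.mem_univ i, (hnonneg i).lt_of_ne' hi⟩
    refine ⟨(v, (∑ i, a i)⁻¹ • a), ⟨⟨by simpa using hv, fun i => ?_, ?_⟩, ?_⟩, rfl⟩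
    · exact mul_nonneg (inv_nonneg.2 hpos.le) (hnonneg i)
    · simp [← Finset.mul_sum, hpos.ne']
    · simp [mul_smul, ← Finset.smul_sum, hsum]
  · rintro ⟨⟨v, a⟩, ⟨⟨hv, hnonneg, hone⟩, hsum⟩, rfl⟩
    refine ⟨v, by simpa using hv, ⟨a, ?_, hnonneg, hsum⟩, rfl⟩
    rintro rfl
    simp at hone

theorem simplexGramMatrices_subset (n : ℕ) :
    simplexGramMatrices n ⊆ degenerateSimplexGramMatrices n := by
  rintro A ⟨v, hv, -, ⟨a, ha, hsum⟩, hA⟩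
  exact ⟨v, hv, ⟨a, fun h => (ha 0).ne' (congrFun h 0), fun i => (ha i).le, hsum⟩, hA⟩

/-- The closure of the set `Z_{n+1}` of angle Gram matrices of Euclidean `n`-simplexes
(Gram matrices of tuples of unit vectors satisfying condition (4.2) of Lemma 4) is exactly
the set of Gram matrices of tuples of unit vectors admitting a nonzero nonnegative linear
dependence. -/
theorem closure_euclidean_gram_matrices
    (n : ℕ) (hn : 1 ≤ n) :
    closure {A : Matrix (Fin (n + 1)) (Fin (n + 1)) ℝ |
        ∃ v : Fin (n + 1) → EuclideanSpace ℝ (Fin n),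
          (∀ i, ‖v i‖ = 1) ∧
          (∀ i : Fin (n + 1), LinearIndependent ℝ (fun j : Fin n => v (i.succAbove j))) ∧
          (∃ a : Fin (n + 1) → ℝ, (∀ i, 0 < a i) ∧ ∑ i, a i • v i = 0) ∧
          A = Matrix.of (fun i j => ⟪v i, v j⟫)} =
      {A : Matrix (Fin (n + 1)) (Fin (n + 1)) ℝ |
        ∃ v : Fin (n + 1) → EuclideanSpace ℝ (Fin n),
          (∀ i, ‖v i‖ = 1) ∧
          (∃ a : Fin (n + 1) → ℝ, a ≠ 0 ∧ (∀ i, 0 ≤ a i) ∧ ∑ i, a i • v i = 0) ∧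
          A = Matrix.of (fun i j => ⟪v i, v j⟫)} := by
  exact (closure_minimal (simplexGramMatrices_subset n)
    (isClosed_degenerateSimplexGramMatrices n)).antisymm
      (degenerateSimplexGramMatrices_subset_closure n)
end

section
/- Let n ≥ 1 and let A be an (n+1)×(n+1) real symmetric matrix with all diagonal entries equal to 1. Then A is of the form [v_i·v_j]_{1≤i,j≤n+1} for some unit vectors v_1, ..., v_{n+1} in R^n such that ∑_{i=1}^{n+1} a_i v_i = 0 has a nonzero solution with all a_i ≥ 0, if and only if: det(A) = 0, A is positive semi-definite, and there exists a principal (k+1)×(k+1) submatrix B of A (for some 1 ≤ k ≤ n) such that det(B) = 0, every entry of the adjugate ad(B) is nonnegative, and ad(B) ≠ 0. -/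
open RealInnerProductSpace

section LinearDependence

variable {ι κ V : Type*} [Fintype ι] [Fintype κ] [AddCommGroup V] [Module ℝ V]

theorem sum_extend_zero_smul {f : κ → ι} (hf : Function.Injective f) (c : κ → ℝ) (v : ι → V) :
    ∑ i, Function.extend f c 0 i • v i = ∑ j, c j • v (f j) := by
  refine (Fintype.sum_of_injective f hf _ _ (fun i hi => ?_) fun j => ?_).symm
  · rw [Function.extend_apply' _ _ _ (by simpa using hi)]
    simp
  · rw [hf.extend_apply]

/-- A nonnegative dependence of minimal support spans the dependences supported on its support. -/
theorem exists_minimal_nonneg_dependence {v : ι → V}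
    (h : ∃ a : ι → ℝ, a ≠ 0 ∧ (∀ i, 0 ≤ a i) ∧ ∑ i, a i • v i = 0) :
    ∃ a : ι → ℝ, a ≠ 0 ∧ (∀ i, 0 ≤ a i) ∧ ∑ i, a i • v i = 0 ∧
      ∀ c : ι → ℝ, (∀ i, a i = 0 → c i = 0) → ∑ i, c i • v i = 0 → ∃ t : ℝ, c = t • a := by
  classical
  let S : Set (ι → ℝ) := {a | a ≠ 0 ∧ (∀ i, 0 ≤ a i) ∧ ∑ i, a i • v i = 0}
  let supportCard : (ι → ℝ) → ℕ := fun a => (Finset.univ.filter fun i => a i ≠ 0).card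
  obtain ⟨a, ⟨ha, hnonneg, hsum⟩, hmin⟩ :=
    (InvImage.wf supportCard wellFounded_lt).has_min S h
  refine ⟨a, ha, hnonneg, hsum, fun c hc hcsum => ?_⟩
  have hne : (Finset.univ.filter fun i => a i ≠ 0).Nonempty := by
    obtain ⟨i, hi⟩ := Function.ne_iff.mp ha
    exact ⟨i, by simpa using hi⟩
  obtain ⟨m, hm, hle⟩ := Finset.exists_min_image _ (fun i => c i / a i) hne
  have hm' : a m ≠ 0 := by simpa using hm
  refine ⟨c m / a m, ?_⟩
  by_contra hcne
  refine hmin (c - (c m / a m) • a) ⟨sub_ne_zero.mpr hcne, fun i => ?_, ?_⟩ ?_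
  · by_cases hi : a i = 0
    · simp [hi, hc i hi]
    · have hpos : 0 < a i := lt_of_le_of_ne (hnonneg i) (Ne.symm hi)
      have := (le_div_iff₀ hpos).mp (hle i (by simpa using hi))
      simpa using this
  · simp [sub_smul, mul_smul, Finset.sum_sub_distrib, ← Finset.smul_sum, hcsum, hsum]
  · refine Finset.card_lt_card (Finset.ssubset_iff_of_subset ?_ |>.mpr ⟨m, hm, ?_⟩)
    · intro i
      simp only [Finset.mem_filter, Finset.mem_univ, true_and]
      intro h0 hi
      exact h0 (by simp [hi, hc i hi])
    · simp [hm']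

end LinearDependence

namespace Matrix

variable {E : Type*} [NormedAddCommGroup E] [InnerProductSpace ℝ E]

theorem gram_mulVec_eq_zero_iff {ι : Type*} [Fintype ι] (v : ι → E) (c : ι → ℝ) :
    gram ℝ v *ᵥ c = 0 ↔ ∑ i, c i • v i = 0 := by
  constructor <;> intro h
  · have := star_dotProduct_gram_mulVec (𝕜 := ℝ) v c c
    rw [h, dotProduct_zero] at this
    exact inner_self_eq_zero.mp this.symm
  · ext i
    have : (gram ℝ v *ᵥ c) i = inner ℝ (v i) (∑ j, c j • v j) := by
      simp [mulVec, dotProduct, inner_sum, inner_smul_right, mul_comm]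
    rw [this, h, inner_zero_right, Pi.zero_apply]

/-- The adjugate of the Gram matrix of vectors whose dependences are all multiples of a single
positive one has positive entries. -/
theorem adjugate_gram_pos {k : ℕ} {w : Fin (k + 1) → E} {b : Fin (k + 1) → ℝ}
    (hb : ∀ i, 0 < b i) (hsum : ∑ i, b i • w i = 0)
    (huniq : ∀ c : Fin (k + 1) → ℝ, ∑ i, c i • w i = 0 → ∃ t : ℝ, c = t • b) (i j) :
    0 < (gram ℝ w).adjugate i j := by
  have hdet : (gram ℝ w).det = 0 :=
    exists_mulVec_eq_zero_iff.mp
      ⟨b, fun h => (hb 0).ne' (congrFun h 0), (gram_mulVec_eq_zero_iff w b).mpr hsum⟩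
  have hdiag : 0 < (gram ℝ w).adjugate j j := by
    rw [adjugate_fin_succ_eq_det_submatrix, Even.neg_one_pow ⟨_, rfl⟩, one_mul]
    change 0 < (gram ℝ (w ∘ j.succAbove)).det
    refine (posDef_gram_of_linearIndependent ?_).det_pos
    rw [Fintype.linearIndependent_iff]
    intro g hg l
    obtain ⟨t, ht⟩ := huniq (j.insertNth 0 g) (by simpa [Fin.sum_univ_succAbove _ j] using hg)
    have hj : t = 0 := by simpa [(hb j).ne'] using (congrFun ht j).symm
    simpa [hj] using congrFun ht (j.succAbove l)
  have hker : gram ℝ w *ᵥ (gram ℝ w).adjugate.col j = 0 := by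
    ext l
    have := congrFun (congrFun (mul_adjugate (gram ℝ w)) l) j
    rw [hdet, zero_smul] at this
    exact this
  obtain ⟨t, ht⟩ := huniq _ ((gram_mulVec_eq_zero_iff _ _).mp hker)
  have hcol : ∀ l, (gram ℝ w).adjugate l j = t * b l := fun l => congrFun ht l
  rw [hcol] at hdiag ⊢
  exact mul_pos (pos_of_mul_pos_left hdiag (hb j).le) (hb i)

open scoped MatrixOrder in
/-- A singular positive semidefinite matrix of size `n + 1` is a Gram matrix of vectors in
`n`-dimensional Euclidean space. -/
theorem PosSemidef.exists_gram_eq_of_det_eq_zero {n : ℕ}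
    {A : Matrix (Fin (n + 1)) (Fin (n + 1)) ℝ} (hA : A.PosSemidef) (hdet : A.det = 0) :
    ∃ v : Fin (n + 1) → EuclideanSpace ℝ (Fin n), A = gram ℝ v := by
  obtain ⟨C, rfl⟩ := CStarAlgebra.nonneg_iff_eq_star_mul_self.mp hA.nonneg
  have hC : C.det = 0 := by simpa [star_eq_conjTranspose] using hdet
  obtain ⟨u, hu, huC⟩ := exists_vecMul_eq_zero_iff.mpr hC
  let u' : EuclideanSpace ℝ (Fin (n + 1)) := WithLp.toLp 2 u
  have hu' : u' ≠ 0 := by simpa [u'] using hu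
  have : Fact (Module.finrank ℝ (EuclideanSpace ℝ (Fin (n + 1))) = n + 1) := ⟨by simp⟩
  let e := (OrthonormalBasis.fromOrthogonalSpanSingleton (𝕜 := ℝ) n hu').repr
  let w : Fin (n + 1) → EuclideanSpace ℝ (Fin (n + 1)) := fun i => WithLp.toLp 2 (C.col i)
  have hw : ∀ i, w i ∈ (Submodule.span ℝ {u'})ᗮ := fun i => by
    rw [Submodule.mem_orthogonal_singleton_iff_inner_right]
    simpa [w, u', PiLp.inner_apply, vecMul, dotProduct, mul_comm] using congrFun huC i
  refine ⟨fun i => e ⟨w i, hw i⟩, ?_⟩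
  ext i j
  rw [gram_apply, e.inner_map_map, Submodule.coe_inner]
  simp [w, PiLp.inner_apply, mul_apply, mul_comm]

end Matrix

open Matrix

/-- Theorem 3(a): a symmetric unidiagonal `(n+1)×(n+1)` matrix `A` is in the closure of the
set of angle Gram matrices of Euclidean `n`-simplexes (i.e. is the Gram matrix of unit
vectors in `ℝ^n` admitting a nonzero nonnegative dependence) iff `det A = 0`, `A` is
positive semi-definite, and some principal `(k+1)×(k+1)` submatrix `B` of `A` satisfies
`det B = 0`, `ad(B) ≥ 0` and `ad(B) ≠ 0`. -/
theorem mem_closure_euclidean_gram_iff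
    (n : ℕ) (hn : 1 ≤ n) (A : Matrix (Fin (n + 1)) (Fin (n + 1)) ℝ)
    (hsymm : A.IsSymm) (hdiag : ∀ i, A i i = 1) :
    (∃ v : Fin (n + 1) → EuclideanSpace ℝ (Fin n),
        (∀ i, ‖v i‖ = 1) ∧
        (∃ a : Fin (n + 1) → ℝ, a ≠ 0 ∧ (∀ i, 0 ≤ a i) ∧ ∑ i, a i • v i = 0) ∧
        A = Matrix.of (fun i j => ⟪v i, v j⟫)) ↔
      (A.det = 0 ∧ A.PosSemidef ∧
        ∃ (k : ℕ), 1 ≤ k ∧ k ≤ n ∧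
          ∃ (f : Fin (k + 1) ↪ Fin (n + 1)),
            (A.submatrix f f).det = 0 ∧
            (∀ i j, 0 ≤ (A.submatrix f f).adjugate i j) ∧
            (A.submatrix f f).adjugate ≠ 0) := by
  constructor
  · rintro ⟨v, hv, hdep, hgram⟩
    have hA : A = gram ℝ v := hgram
    clear hgram
    subst hA
    obtain ⟨a, ha, hnonneg, hsum, huniq⟩ := exists_minimal_nonneg_dependence hdep
    refine ⟨exists_mulVec_eq_zero_iff.mp ⟨a, ha, (gram_mulVec_eq_zero_iff v a).mpr hsum⟩,
      posSemidef_gram ℝ v, ?_⟩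
    let S : Finset (Fin (n + 1)) := Finset.univ.filter fun i => a i ≠ 0
    have hS : S.Nonempty := by
      obtain ⟨i, hi⟩ := Function.ne_iff.mp ha
      exact ⟨i, by simpa [S] using hi⟩
    obtain ⟨k, hk⟩ : ∃ k, S.card = k + 1 := Nat.exists_eq_succ_of_ne_zero hS.card_pos.ne'
    let f : Fin (k + 1) ↪ Fin (n + 1) := (S.orderEmbOfFin hk).toEmbedding
    have hf : ∀ i, a (f i) ≠ 0 := fun i => (Finset.mem_filter.mp (S.orderEmbOfFin_mem hk i)).2
    have hrange : ∀ i, a i ≠ 0 → ∃ l, f l = i := fun i hi => by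
      have : i ∈ Set.range (S.orderEmbOfFin hk) := by
        rw [Finset.range_orderEmbOfFin]
        simpa [S] using hi
      exact this
    have hb : ∀ l, 0 < a (f l) := fun l => lt_of_le_of_ne (hnonneg _) (hf l).symm
    have hextend : a = Function.extend f (a ∘ f) 0 := by
      ext i
      by_cases hi : ∃ l, f l = i
      · obtain ⟨l, rfl⟩ := hi
        rw [f.injective.extend_apply, Function.comp_apply]
      · rw [Function.extend_apply' _ _ _ hi]
        exact not_not.mp fun h => hi (hrange i h)
    have hbsum : ∑ l, (a ∘ f) l • (v ∘ f) l = 0 := by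
      have := sum_extend_zero_smul f.injective (a ∘ f) v
      rw [← hextend, hsum] at this
      exact this.symm
    have hpos := adjugate_gram_pos (w := v ∘ f) (b := a ∘ f) hb hbsum fun c hc => by
      obtain ⟨t, ht⟩ := huniq (Function.extend f c 0)
        (fun i hi => Function.extend_apply' _ _ _ (by rintro ⟨l, rfl⟩; exact hf l hi))
        ((sum_extend_zero_smul f.injective c v).trans hc)
      refine ⟨t, funext fun l => ?_⟩
      simpa [f.injective.extend_apply] using congrFun ht (f l)
    refine ⟨k, ?_, ?_, f, ?_, fun i j => (hpos i j).le, fun h => (hpos 0 0).ne' (congrFun₂ h 0 0)⟩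
    · by_contra hk0
      obtain rfl : k = 0 := by omega
      have h0 : v (f 0) = 0 := by simpa [(hf 0)] using hbsum
      simpa [h0] using hv (f 0)
    · have := S.card_le_univ
      rw [hk, Fintype.card_fin] at this
      omega
    · exact exists_mulVec_eq_zero_iff.mp
        ⟨a ∘ f, fun h => hf 0 (congrFun h 0), (gram_mulVec_eq_zero_iff (v ∘ f) _).mpr hbsum⟩
  · rintro ⟨hdet, hpsd, k, -, -, f, hB, hadj, hadj0⟩
    obtain ⟨v, rfl⟩ := hpsd.exists_gram_eq_of_det_eq_zero hdet
    refine ⟨v, fun i => ?_, ?_, rfl⟩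
    · have := hdiag i
      rw [gram_apply, real_inner_self_eq_norm_sq] at this
      exact (pow_eq_one_iff_of_nonneg (norm_nonneg _) two_ne_zero).mp this
    · obtain ⟨i, j, hij⟩ : ∃ i j, ((gram ℝ v).submatrix f f).adjugate i j ≠ 0 := by
        by_contra! h
        exact hadj0 (Matrix.ext h)
      set b := ((gram ℝ v).submatrix f f).adjugate.col j
      have hker : gram ℝ (v ∘ f) *ᵥ b = 0 := by
        ext l
        have := congrFun (congrFun (mul_adjugate ((gram ℝ v).submatrix f f)) l) j
        rw [hB, zero_smul] at this
        exact this
      refine ⟨Function.extend f b 0, fun h => hij ?_, fun l => ?_, ?_⟩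
      · have := congrFun h (f i)
        rwa [f.injective.extend_apply] at this
      · by_cases hl : ∃ m, f m = l
        · obtain ⟨m, rfl⟩ := hl
          rw [f.injective.extend_apply]
          exact hadj m j
        · rw [Function.extend_apply' _ _ _ hl, Pi.zero_apply]
      · rw [sum_extend_zero_smul f.injective]
        exact (gram_mulVec_eq_zero_iff (v ∘ f) b).mp hker
end

section
/- Let n ≥ 1. Let Y_{n+1} be the set of (n+1)×(n+1) real symmetric matrices A with all diagonal entries equal to 1 such that det(A) < 0, every entry of the adjugate ad(A) is positive, and all principal n×n submatrices of A are positive definite. Then an (n+1)×(n+1) real symmetric matrix A with unit diagonal lies in the closure of Y_{n+1} (in the space of (n+1)×(n+1) real matrices) if and only if either A is of the form [v_i·v_j]_{1≤i,j≤n+1} for unit vectors v_1, ..., v_{n+1} in R^n with a nonzero solution of ∑_{i=1}^{n+1} a_i v_i = 0 having all a_i ≥ 0, or det(A) < 0, every entry of ad(A) is nonnegative, and all principal n×n submatrices of A are positive semi-definite. -/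
open RealInnerProductSpace

open Matrix Filter Topology

/-- A real symmetric matrix with negative determinant whose quadratic form is nonnegative on some
hyperplane, i.e. a symmetric matrix of Lorentzian signature. -/
def IsLorentzian {ι : Type*} [Fintype ι] [DecidableEq ι] (M : Matrix ι ι ℝ) : Prop :=
  M.IsSymm ∧ M.det < 0 ∧ ∃ w : ι → ℝ, ∀ y, w ⬝ᵥ y = 0 → 0 ≤ y ⬝ᵥ M *ᵥ y

section General

variable {ι : Type*} [Fintype ι]

theorem Matrix.IsSymm.dotProduct_mulVec_comm {M : Matrix ι ι ℝ} (hM : M.IsSymm) (x y : ι → ℝ) :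
    x ⬝ᵥ M *ᵥ y = y ⬝ᵥ M *ᵥ x := by
  rw [dotProduct_mulVec, dotProduct_comm, ← mulVec_transpose, hM.eq]

/-- The set of matrices whose quadratic form takes a nonpositive value on the standard simplex is
closed. -/
theorem isClosed_exists_stdSimplex_nonpos :
    IsClosed {M : Matrix ι ι ℝ | ∃ b ∈ stdSimplex ℝ ι, b ⬝ᵥ M *ᵥ b ≤ 0} := by
  have hc : IsClosed {p : Matrix ι ι ℝ × stdSimplex ℝ ι | p.2.1 ⬝ᵥ p.1 *ᵥ p.2.1 ≤ 0} :=
    isClosed_le (by fun_prop) continuous_const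
  convert isClosedMap_fst_of_compactSpace _ hc
  ext M
  simp

variable [DecidableEq ι]

/-- Congruence by an invertible symmetric matrix preserves Lorentzian signature. -/
theorem IsLorentzian.congr {M T : Matrix ι ι ℝ} (hM : IsLorentzian M) (hT : T.IsSymm)
    (hdet : T.det ≠ 0) : IsLorentzian (T * M * T) := by
  obtain ⟨hs, hd, w, hw⟩ := hM
  refine ⟨?_, ?_, T *ᵥ w, fun y hy => ?_⟩
  · rw [IsSymm, transpose_mul, transpose_mul, hs.eq, hT.eq, Matrix.mul_assoc]
  · rw [det_mul, det_mul]
    have := mul_self_pos.2 hdet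
    nlinarith
  · have key : y ⬝ᵥ (T * M * T) *ᵥ y = (T *ᵥ y) ⬝ᵥ M *ᵥ (T *ᵥ y) := by
      rw [← mulVec_mulVec, ← mulVec_mulVec, hT.dotProduct_mulVec_comm, dotProduct_comm]
    rw [key]
    refine hw _ ?_
    rw [hT.dotProduct_mulVec_comm, dotProduct_comm, hy]

/-- On the hyperplane of vectors with vanishing `i`-th coordinate, a Lorentzian form with positive
`i`-th diagonal cofactor is nonnegative. -/
theorem IsLorentzian.nonneg_of_adjugate_pos {M : Matrix ι ι ℝ} (hM : IsLorentzian M) {i : ι}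
    (hi : 0 < M.adjugate i i) {x : ι → ℝ} (hx : x i = 0) : 0 ≤ x ⬝ᵥ M *ᵥ x := by
  obtain ⟨hs, hd, w, hw⟩ := hM
  set z : ι → ℝ := M.adjugate *ᵥ Pi.single i 1 with hz
  have hMz : M *ᵥ z = M.det • Pi.single i 1 := by
    rw [hz, mulVec_mulVec, mul_adjugate, smul_mulVec, one_mulVec]
  have hzi : z i = M.adjugate i i := by simp [hz]
  have hzz : z ⬝ᵥ M *ᵥ z = M.det * M.adjugate i i := by
    rw [hMz, dotProduct_smul, dotProduct_single, hzi]; simp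
  have hxz : x ⬝ᵥ M *ᵥ z = 0 := by
    rw [hMz, dotProduct_smul, dotProduct_single, hx]; simp
  have hneg : z ⬝ᵥ M *ᵥ z < 0 := by rw [hzz]; exact mul_neg_of_neg_of_pos hd hi
  have hwz : w ⬝ᵥ z ≠ 0 := fun h => hneg.not_ge (hw z h)
  set β := w ⬝ᵥ x / w ⬝ᵥ z with hβ
  have h0 := hw (x - β • z) (by
    rw [dotProduct_sub, dotProduct_smul, hβ, smul_eq_mul, div_mul_cancel₀ _ hwz, sub_self])
  have hexp : (x - β • z) ⬝ᵥ M *ᵥ (x - β • z) = x ⬝ᵥ M *ᵥ x + β ^ 2 * (z ⬝ᵥ M *ᵥ z) := by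
    simp only [mulVec_sub, mulVec_smul, dotProduct_sub, sub_dotProduct, dotProduct_smul,
      smul_dotProduct, smul_eq_mul, hxz, hs.dotProduct_mulVec_comm z x]
    ring
  rw [hexp] at h0
  nlinarith [sq_nonneg β]

/-- Rank-one determinant update in the direction `N *ᵥ c`. -/
theorem det_sub_smul_vecMulVec {N : Matrix ι ι ℝ} (c : ι → ℝ) (s : ℝ) :
    (N - s • vecMulVec (N *ᵥ c) (N *ᵥ c)).det = N.det * (1 - s * (c ⬝ᵥ N *ᵥ c)) := by
  have h : N - s • vecMulVec (N *ᵥ c) (N *ᵥ c) =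
      N * (1 + replicateCol Unit (-s • c) * replicateRow Unit (N *ᵥ c)) := by
    rw [← vecMulVec_eq, Matrix.mul_add, Matrix.mul_one, mul_vecMulVec, mulVec_smul, smul_vecMulVec,
      neg_smul, sub_eq_add_neg]
  rw [h, det_mul, det_one_add_replicateCol_mul_replicateRow, dotProduct_smul, dotProduct_comm,
    smul_eq_mul]
  ring

/-- Rank-one adjugate update in the direction `N *ᵥ c`. -/
theorem adjugate_sub_smul_vecMulVec {N : Matrix ι ι ℝ} (hN : N.IsSymm) (c : ι → ℝ) (s : ℝ)
    (h : (N - s • vecMulVec (N *ᵥ c) (N *ᵥ c)).det ≠ 0) :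
    (N - s • vecMulVec (N *ᵥ c) (N *ᵥ c)).adjugate =
      (1 - s * (c ⬝ᵥ N *ᵥ c)) • N.adjugate + (s * N.det) • vecMulVec c c := by
  set M := N - s • vecMulVec (N *ᵥ c) (N *ᵥ c) with hM
  set X := (1 - s * (c ⬝ᵥ N *ᵥ c)) • N.adjugate + (s * N.det) • vecMulVec c c with hX
  have hvec : (N *ᵥ c) ᵥ* N.adjugate = N.det • c := by
    rw [← vecMul_transpose, hN.eq, vecMul_vecMul, mul_adjugate, vecMul_smul, vecMul_one]
  have hMX : M * X = M.det • 1 := by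
    rw [hM, det_sub_smul_vecMulVec, hX]
    simp only [Matrix.sub_mul, Matrix.mul_add, Matrix.mul_smul, Matrix.smul_mul, mul_adjugate,
      mul_vecMulVec, vecMulVec_mul, hvec, vecMulVec_smul, smul_smul, sub_mulVec, smul_mulVec,
      vecMulVec_mulVec, sub_vecMulVec, smul_vecMulVec, op_smul_eq_smul]
    rw [dotProduct_comm (N *ᵥ c) c]
    module
  have h1 : M.adjugate * (M * X) = M.det • X := by
    rw [← Matrix.mul_assoc, adjugate_mul, Matrix.smul_mul, Matrix.one_mul]
  rw [hMX, Matrix.mul_smul, Matrix.mul_one] at h1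
  exact smul_right_injective _ h h1

/-- Subtracting from a positive definite `N` the rank-one matrix that makes a positive vector `c`
isotropic yields a limit of Lorentzian matrices with positive adjugate. -/
theorem Matrix.PosDef.sub_vecMulVec_mem_closure [Nonempty ι] {N : Matrix ι ι ℝ} (hN : N.PosDef)
    {c : ι → ℝ} (hc : ∀ i, 0 < c i) :
    N - (c ⬝ᵥ N *ᵥ c)⁻¹ • vecMulVec (N *ᵥ c) (N *ᵥ c) ∈
      closure {M : Matrix ι ι ℝ | IsLorentzian M ∧ ∀ i j, 0 < M.adjugate i j} := by
  have hsymm : N.IsSymm := by simpa [IsHermitian, IsSymm] using hN.isHermitian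
  have hc0 : c ≠ 0 := fun h => (hc (Classical.arbitrary ι)).ne' (by simp [h])
  have hq : 0 < c ⬝ᵥ N *ᵥ c := by simpa using hN.dotProduct_mulVec_pos hc0
  have hdet : 0 < N.det := hN.det_pos
  set q := c ⬝ᵥ N *ᵥ c with hqdef
  have hcont : Continuous fun s : ℝ => N - s • vecMulVec (N *ᵥ c) (N *ᵥ c) := by fun_prop
  refine mem_closure_of_tendsto (b := 𝓝[>] q⁻¹)
    (hcont.continuousAt.tendsto.mono_left nhdsWithin_le_nhds) ?_
  have hpos : ∀ᶠ s in 𝓝[>] q⁻¹, ∀ i j,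
      0 < ((1 - s * q) • N.adjugate + (s * N.det) • vecMulVec c c) i j := by
    refine eventually_all.2 fun i => eventually_all.2 fun j => ?_
    refine Filter.Eventually.filter_mono nhdsWithin_le_nhds ?_
    have hct : Continuous fun s : ℝ =>
        ((1 - s * q) • N.adjugate + (s * N.det) • vecMulVec c c) i j := by
      simp only [Matrix.add_apply, Matrix.smul_apply]; fun_prop
    refine hct.continuousAt.eventually (lt_mem_nhds ?_)
    simp only [Matrix.add_apply, Matrix.smul_apply, vecMulVec_apply, inv_mul_cancel₀ hq.ne',
      sub_self, smul_eq_mul, zero_mul, zero_add]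
    have := hc i
    have := hc j
    positivity
  filter_upwards [hpos, self_mem_nhdsWithin] with s hs hsq
  have hsq' : 1 < s * q := by
    have := mul_lt_mul_of_pos_right (Set.mem_Ioi.1 hsq) hq
    rwa [inv_mul_cancel₀ hq.ne'] at this
  have hlt : (N - s • vecMulVec (N *ᵥ c) (N *ᵥ c)).det < 0 := by
    rw [det_sub_smul_vecMulVec]
    exact mul_neg_of_pos_of_neg hdet (by linarith)
  refine ⟨⟨?_, hlt, N *ᵥ c, fun y hy => ?_⟩, ?_⟩
  · rw [IsSymm, transpose_sub, hsymm.eq, transpose_smul, transpose_vecMulVec]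
  · rw [sub_mulVec, smul_mulVec, vecMulVec_mulVec, hy]
    simpa using hN.posSemidef.dotProduct_mulVec_nonneg y
  · rw [adjugate_sub_smul_vecMulVec hsymm c s hlt.ne]
    exact hs

/-- A singular positive semidefinite matrix with a nonnegative null vector is a limit of
Lorentzian matrices with positive adjugate. -/
theorem Matrix.PosSemidef.mem_closure_isLorentzian {A : Matrix ι ι ℝ}
    (hA : A.PosSemidef) {b : ι → ℝ} (hb0 : b ≠ 0) (hb : ∀ i, 0 ≤ b i) (hAb : A *ᵥ b = 0) :
    A ∈ closure {M : Matrix ι ι ℝ | IsLorentzian M ∧ ∀ i j, 0 < M.adjugate i j} := by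
  have : Nonempty ι := by
    by_contra h
    rw [not_nonempty_iff] at h
    exact hb0 (Subsingleton.elim _ _)
  set c : ℝ → ι → ℝ := fun t => b + t • 1 with hcdef
  set u : ℝ → ι → ℝ := fun t => A *ᵥ 1 + c t with hu
  set r : ℝ → ℝ := fun t => t * (1 ⬝ᵥ A *ᵥ 1) + c t ⬝ᵥ c t with hr
  have hsymm : A.IsSymm := by simpa [IsHermitian, IsSymm] using hA.isHermitian
  have hcc : Continuous c := by fun_prop
  have huc : Continuous u := by fun_prop
  have hrc : Continuous r := by fun_prop
  have hr0 : r 0 ≠ 0 := by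
    simp only [hr, hcdef, zero_mul, zero_smul, add_zero, zero_add]
    exact fun h => hb0 (dotProduct_self_eq_zero.1 h)
  have hlim : Tendsto (fun t : ℝ => A + t • 1 - (t * (r t)⁻¹) • vecMulVec (u t) (u t))
      (𝓝[>] 0) (𝓝 A) := by
    have hct : ContinuousAt
        (fun t : ℝ => A + t • 1 - (t * (r t)⁻¹) • vecMulVec (u t) (u t)) 0 := by
      refine ContinuousAt.sub (by fun_prop) (ContinuousAt.fun_smul ?_ ?_)
      · exact continuousAt_id.mul (hrc.continuousAt.inv₀ hr0)
      · exact (huc.matrix_vecMulVec huc).continuousAt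
    simpa using hct.tendsto.mono_left nhdsWithin_le_nhds
  rw [← closure_closure]
  refine mem_closure_of_tendsto hlim ?_
  filter_upwards [self_mem_nhdsWithin] with t (ht : 0 < t)
  have hN : (A + t • 1).PosDef := (PosDef.one.smul ht).posSemidef_add hA
  have hcpos : ∀ i, 0 < c t i := fun i => by
    have := hb i
    simp only [hcdef, Pi.add_apply, Pi.smul_apply, Pi.one_apply, smul_eq_mul, mul_one]
    linarith
  have hAc : A *ᵥ c t = t • A *ᵥ 1 := by
    simp only [hcdef, mulVec_add, hAb, mulVec_smul, zero_add]
  have hNc : (A + t • 1) *ᵥ c t = t • u t := by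
    rw [add_mulVec, hAc, smul_mulVec, one_mulVec, ← smul_add]
  have hq : c t ⬝ᵥ (A + t • 1) *ᵥ c t = t * r t := by
    have h1 : c t ⬝ᵥ A *ᵥ 1 = t * (1 ⬝ᵥ A *ᵥ 1) := by
      rw [hsymm.dotProduct_mulVec_comm, hAc, dotProduct_smul, smul_eq_mul]
    rw [hNc, dotProduct_smul, hu, dotProduct_add, h1, smul_eq_mul]
  have hmem := hN.sub_vecMulVec_mem_closure hcpos
  rw [hq, hNc, smul_vecMulVec, vecMulVec_smul, smul_smul, smul_smul] at hmem
  convert hmem using 3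
  field_simp

/-- A Lorentzian matrix with nonnegative adjugate is a limit of Lorentzian matrices with positive
adjugate. -/
theorem IsLorentzian.mem_closure [Nontrivial ι] {A : Matrix ι ι ℝ} (hA : IsLorentzian A)
    (had : ∀ i j, 0 ≤ A.adjugate i j) :
    A ∈ closure {M : Matrix ι ι ℝ | IsLorentzian M ∧ ∀ i j, 0 < M.adjugate i j} := by
  set Q : ℝ → Matrix ι ι ℝ := fun t => 1 + t • of fun _ _ => 1 with hQ
  have hQc : Continuous Q := by fun_prop
  have hQ0 : Q 0 = 1 := by simp [hQ]
  have hQs : ∀ t, (Q t).IsSymm := fun t => by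
    ext i j; simp [hQ, Matrix.one_apply, eq_comm]
  have hlim : Tendsto (fun t => (Q t).adjugate * A * (Q t).adjugate) (𝓝[>] 0) (𝓝 A) := by
    have hct : Continuous fun t => (Q t).adjugate * A * (Q t).adjugate := by fun_prop
    simpa [hQ0] using (hct.tendsto 0).mono_left nhdsWithin_le_nhds
  have hdet : ∀ᶠ t in 𝓝[>] (0 : ℝ), 0 < (Q t).det := by
    refine Filter.Eventually.filter_mono nhdsWithin_le_nhds ?_
    have hct : Continuous fun t => (Q t).det := by fun_prop
    exact hct.continuousAt.eventually (lt_mem_nhds (by simp [hQ0]))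
  refine mem_closure_of_tendsto hlim ?_
  filter_upwards [hdet, self_mem_nhdsWithin] with t hd (ht : 0 < t)
  have hQpos : ∀ i j, 0 < Q t i j := fun i j => by
    simp only [hQ, Matrix.add_apply, Matrix.one_apply, Matrix.smul_apply, of_apply, smul_eq_mul,
      mul_one]
    split_ifs <;> linarith
  refine ⟨hA.congr ?_ ?_, fun i j => ?_⟩
  · rw [IsSymm, adjugate_transpose, (hQs t).eq]
  · rw [det_adjugate]; exact (pow_pos hd _).ne'
  · rw [adjugate_mul_distrib, adjugate_mul_distrib, adjugate_adjugate', Matrix.smul_mul,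
      Matrix.mul_smul, Matrix.mul_smul, Matrix.smul_apply, Matrix.smul_apply, smul_eq_mul,
      smul_eq_mul]
    refine mul_pos (pow_pos hd _) (mul_pos (pow_pos hd _) ?_)
    obtain ⟨k, l, hkl⟩ : ∃ k l, 0 < A.adjugate k l := by
      by_contra! hcon
      have hz : A.adjugate = 0 := by
        ext k l; exact le_antisymm (hcon k l) (had k l)
      have h1 := mul_adjugate A
      rw [hz, Matrix.mul_zero, eq_comm, smul_eq_zero] at h1
      exact h1.elim hA.2.1.ne one_ne_zero
    have hnn : ∀ a, 0 ≤ (A.adjugate * Q t) a j := fun a =>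
      Finset.sum_nonneg fun m _ => mul_nonneg (had a m) (hQpos m j).le
    have hp : 0 < (A.adjugate * Q t) k j :=
      Finset.sum_pos' (fun m _ => mul_nonneg (had k m) (hQpos m j).le)
        ⟨l, Finset.mem_univ _, mul_pos hkl (hQpos l j)⟩
    exact Finset.sum_pos' (fun m _ => mul_nonneg (hQpos i m).le (hnn m))
      ⟨k, Finset.mem_univ _, mul_pos (hQpos i k) hp⟩

end General

section Fin

variable {n : ℕ}

/-- The quadratic form at a vector with vanishing `i`-th coordinate only depends on the principal
submatrix omitting `i`. -/
theorem dotProduct_mulVec_eq_submatrix_succAbove (M : Matrix (Fin (n + 1)) (Fin (n + 1)) ℝ)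
    {i : Fin (n + 1)} {x : Fin (n + 1) → ℝ} (hx : x i = 0) :
    x ⬝ᵥ M *ᵥ x = (x ∘ i.succAbove) ⬝ᵥ
      (M.submatrix i.succAbove i.succAbove) *ᵥ (x ∘ i.succAbove) := by
  simp [dotProduct, mulVec, Fin.sum_univ_succAbove _ i, hx]

theorem adjugate_self_eq_det_submatrix (M : Matrix (Fin (n + 1)) (Fin (n + 1)) ℝ)
    (i : Fin (n + 1)) : M.adjugate i i = (M.submatrix i.succAbove i.succAbove).det := by
  rw [adjugate_fin_succ_eq_det_submatrix, Even.neg_one_pow ⟨_, rfl⟩, one_mul]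

theorem IsLorentzian.posDef_submatrix {M : Matrix (Fin (n + 1)) (Fin (n + 1)) ℝ}
    (hM : IsLorentzian M) {i : Fin (n + 1)} (hi : 0 < M.adjugate i i) :
    (M.submatrix i.succAbove i.succAbove).PosDef := by
  have hpsd : (M.submatrix i.succAbove i.succAbove).PosSemidef := by
    refine .of_dotProduct_mulVec_nonneg ?_ fun y => ?_
    · simpa [IsHermitian, IsSymm] using hM.1.submatrix i.succAbove
    · have h := hM.nonneg_of_adjugate_pos hi (x := i.insertNth 0 y) (by simp)
      rw [dotProduct_mulVec_eq_submatrix_succAbove M (i := i) (by simp)] at h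
      have hy : (i.insertNth 0 y : Fin (n + 1) → ℝ) ∘ i.succAbove = y := by
        ext k; simp
      rw [hy] at h
      simpa using h
  rw [hpsd.posDef_iff_det_ne_zero, ← adjugate_self_eq_det_submatrix]
  exact ne_of_gt hi

/-- A singular symmetric matrix with positive semidefinite principal submatrices of corank one is
positive semidefinite. -/
theorem posSemidef_of_det_eq_zero {A : Matrix (Fin (n + 1)) (Fin (n + 1)) ℝ} (hA : A.IsSymm)
    (hdet : A.det = 0)
    (hsub : ∀ i : Fin (n + 1), (A.submatrix i.succAbove i.succAbove).PosSemidef) :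
    A.PosSemidef := by
  obtain ⟨w, hw0, hw⟩ := exists_mulVec_eq_zero_iff.2 hdet
  obtain ⟨i, hi⟩ := Function.ne_iff.1 hw0
  refine .of_dotProduct_mulVec_nonneg (by simpa [IsHermitian, IsSymm] using hA) fun x => ?_
  set β := x i / w i with hβ
  have hxi : (x - β • w) i = 0 := by
    simp [hβ, div_mul_cancel₀ _ hi]
  have h := (hsub i).dotProduct_mulVec_nonneg ((x - β • w) ∘ i.succAbove)
  rw [star_trivial, ← dotProduct_mulVec_eq_submatrix_succAbove A hxi] at h
  have hwx : w ⬝ᵥ A *ᵥ x = 0 := by rw [hA.dotProduct_mulVec_comm, hw, dotProduct_zero]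
  simpa [mulVec_sub, mulVec_smul, hw, sub_dotProduct, hwx] using h

open scoped MatrixOrder in
/-- A singular positive semidefinite matrix of size `n + 1` is a Gram matrix of vectors in
`n`-dimensional Euclidean space. -/
theorem Matrix.PosSemidef.exists_eq_gram {A : Matrix (Fin (n + 1)) (Fin (n + 1)) ℝ}
    (hA : A.PosSemidef) (hdet : A.det = 0) :
    ∃ v : Fin (n + 1) → EuclideanSpace ℝ (Fin n), A = gram ℝ v := by
  obtain ⟨B, hB⟩ := CStarAlgebra.nonneg_iff_eq_star_mul_self.mp hA.nonneg
  have hBdet : B.det = 0 := by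
    rw [hB, star_eq_conjTranspose, det_mul, det_conjTranspose] at hdet
    simpa using hdet
  obtain ⟨u, hu0, hu⟩ := exists_vecMul_eq_zero_iff.2 hBdet
  have hu' : WithLp.toLp 2 u ≠ (0 : EuclideanSpace ℝ (Fin (n + 1))) := by simpa using hu0
  have : Fact (Module.finrank ℝ (EuclideanSpace ℝ (Fin (n + 1))) = n + 1) := ⟨by simp⟩
  set col : Fin (n + 1) → EuclideanSpace ℝ (Fin (n + 1)) := fun j => WithLp.toLp 2 (B.col j)
  have hmem : ∀ j, col j ∈ (ℝ ∙ (WithLp.toLp 2 u : EuclideanSpace ℝ (Fin (n + 1))))ᗮ := fun j => by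
    rw [Submodule.mem_orthogonal_singleton_iff_inner_left]
    have := congrFun hu j
    simpa [col, PiLp.inner_apply, vecMul, dotProduct] using this
  refine ⟨fun j => (OrthonormalBasis.fromOrthogonalSpanSingleton n hu').repr ⟨col j, hmem j⟩, ?_⟩
  ext i j
  rw [gram_apply, LinearIsometryEquiv.inner_map_map, hB]
  simp [col, PiLp.inner_apply, Matrix.mul_apply, mul_comm]

/-- The matrices satisfying the conditions that characterise angle Gram matrices of hyperbolic
`n`-simplexes. -/
def hyperbolicGram (n : ℕ) : Set (Matrix (Fin (n + 1)) (Fin (n + 1)) ℝ) :=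
  {M | M.IsSymm ∧ (∀ i, M i i = 1) ∧ M.det < 0 ∧ (∀ i j, 0 < M.adjugate i j) ∧
    ∀ i : Fin (n + 1), (M.submatrix i.succAbove i.succAbove).PosDef}

/-- The column of a positive adjugate, normalised to lie in the standard simplex, is a nonpositive
vector for the form. -/
theorem exists_stdSimplex_nonpos {M : Matrix (Fin (n + 1)) (Fin (n + 1)) ℝ} (hdet : M.det < 0)
    (had : ∀ i j, 0 < M.adjugate i j) : ∃ b ∈ stdSimplex ℝ (Fin (n + 1)), b ⬝ᵥ M *ᵥ b ≤ 0 := by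
  set z : Fin (n + 1) → ℝ := M.adjugate *ᵥ Pi.single 0 1 with hz
  have hzpos : ∀ i, 0 < z i := fun i => by simpa [hz] using had i 0
  set S := ∑ i, z i with hS
  have hSpos : 0 < S := Finset.sum_pos (fun i _ => hzpos i) Finset.univ_nonempty
  have hMz : M *ᵥ z = M.det • Pi.single 0 1 := by
    rw [hz, mulVec_mulVec, mul_adjugate, smul_mulVec, one_mulVec]
  refine ⟨S⁻¹ • z, ⟨fun i => ?_, ?_⟩, ?_⟩
  · exact mul_nonneg (inv_nonneg.2 hSpos.le) (hzpos i).le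
  · simp only [Pi.smul_apply, smul_eq_mul, ← Finset.mul_sum]
    exact inv_mul_cancel₀ hSpos.ne'
  · rw [mulVec_smul, hMz, smul_dotProduct, dotProduct_smul, dotProduct_smul, dotProduct_single]
    simp only [smul_eq_mul, mul_one]
    have := mul_neg_of_neg_of_pos hdet (hzpos 0)
    have h2 : 0 < S⁻¹ * S⁻¹ := by positivity
    nlinarith

theorem hyperbolicGram_closure_subset :
    closure (hyperbolicGram n) ⊆
      {M | M.det ≤ 0 ∧ (∀ i j, 0 ≤ M.adjugate i j) ∧
        (∀ i : Fin (n + 1), ∀ x, 0 ≤ x ⬝ᵥ M.submatrix i.succAbove i.succAbove *ᵥ x) ∧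
        ∃ b ∈ stdSimplex ℝ (Fin (n + 1)), b ⬝ᵥ M *ᵥ b ≤ 0} := by
  refine closure_minimal ?_ ?_
  · rintro M ⟨-, -, hd, had, hp⟩
    exact ⟨hd.le, fun i j => (had i j).le,
      fun i x => by simpa using (hp i).posSemidef.dotProduct_mulVec_nonneg x,
      exists_stdSimplex_nonpos hd had⟩
  · have hadj : IsClosed {M : Matrix (Fin (n + 1)) (Fin (n + 1)) ℝ |
        ∀ i j, 0 ≤ M.adjugate i j} := by
      simp only [Set.ofPred_forall]
      exact isClosed_iInter fun i => isClosed_iInter fun j =>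
        isClosed_le continuous_const (continuous_id.matrix_adjugate.matrix_elem i j)
    have hsub : IsClosed {M : Matrix (Fin (n + 1)) (Fin (n + 1)) ℝ | ∀ i : Fin (n + 1), ∀ x,
        0 ≤ x ⬝ᵥ M.submatrix i.succAbove i.succAbove *ᵥ x} := by
      simp only [Set.ofPred_forall]
      exact isClosed_iInter fun i => isClosed_iInter fun x =>
        isClosed_le continuous_const (by fun_prop)
    exact (isClosed_le continuous_id.matrix_det continuous_const).inter
      (hadj.inter (hsub.inter isClosed_exists_stdSimplex_nonpos))

/-- Rescaling to unit diagonal turns a Lorentzian matrix with positive adjugate into an element of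
`hyperbolicGram`. -/
theorem IsLorentzian.diagonal_mul_mul_diagonal_mem (hn : 1 ≤ n)
    {M : Matrix (Fin (n + 1)) (Fin (n + 1)) ℝ} (hM : IsLorentzian M)
    (had : ∀ i j, 0 < M.adjugate i j) :
    diagonal (fun i => (√(M i i))⁻¹) * M * diagonal (fun i => (√(M i i))⁻¹) ∈
      hyperbolicGram n := by
  have : Nontrivial (Fin (n + 1)) := Fin.nontrivial_iff_two_le.2 (by omega)
  have hpos : ∀ i, 0 < M i i := fun i => by
    obtain ⟨j, hj⟩ := exists_ne i
    obtain ⟨k, rfl⟩ := Fin.exists_succAbove_eq hj.symm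
    exact (hM.posDef_submatrix (had j j)).diag_pos (i := k)
  set d : Fin (n + 1) → ℝ := fun i => (√(M i i))⁻¹ with hd
  have hdpos : ∀ i, 0 < d i := fun i => inv_pos.2 (Real.sqrt_pos.2 (hpos i))
  have hL : IsLorentzian (diagonal d * M * diagonal d) := by
    refine hM.congr (isSymm_diagonal d) ?_
    rw [det_diagonal]
    exact (Finset.prod_pos fun i _ => hdpos i).ne'
  have hadj : ∀ i j, 0 < (diagonal d * M * diagonal d).adjugate i j := fun i j => by
    rw [adjugate_mul_distrib, adjugate_mul_distrib, adjugate_diagonal, diagonal_mul,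
      mul_diagonal]
    exact mul_pos (Finset.prod_pos fun i _ => hdpos i)
      (mul_pos (had i j) (Finset.prod_pos fun i _ => hdpos i))
  refine ⟨hL.1, fun i => ?_, hL.2.1, hadj, fun i => hL.posDef_submatrix (hadj i i)⟩
  rw [mul_diagonal, diagonal_mul, hd]
  have h := Real.mul_self_sqrt (hpos i).le
  have h' := (Real.sqrt_pos.2 (hpos i)).ne'
  field_simp
  rw [sq, h]

theorem mem_closure_hyperbolicGram_of_isLorentzian (hn : 1 ≤ n)
    {A : Matrix (Fin (n + 1)) (Fin (n + 1)) ℝ} (hdiag : ∀ i, A i i = 1)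
    (hA : A ∈ closure {M : Matrix (Fin (n + 1)) (Fin (n + 1)) ℝ |
      IsLorentzian M ∧ ∀ i j, 0 < M.adjugate i j}) :
    A ∈ closure (hyperbolicGram n) := by
  set f : Matrix (Fin (n + 1)) (Fin (n + 1)) ℝ → Matrix (Fin (n + 1)) (Fin (n + 1)) ℝ :=
    fun M => diagonal (fun i => (√(M i i))⁻¹) * M * diagonal (fun i => (√(M i i))⁻¹) with hf
  have hfA : f A = A := by simp [hf, hdiag]
  have hcont : ContinuousAt f A := by
    refine continuousAt_pi.2 fun i => continuousAt_pi.2 fun j => ?_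
    simp only [hf, mul_diagonal, diagonal_mul]
    have hs : ∀ k, ContinuousAt (fun M : Matrix (Fin (n + 1)) (Fin (n + 1)) ℝ => (√(M k k))⁻¹) A :=
      fun k => ContinuousAt.inv₀ (continuous_id.matrix_elem k k).sqrt.continuousAt (by simp [hdiag])
    exact ((hs i).mul (continuous_id.matrix_elem i j).continuousAt).mul (hs j)
  rw [← hfA]
  refine closure_mono ?_ (mem_closure_image hcont hA)
  rintro _ ⟨M, ⟨hM, had⟩, rfl⟩
  exact hM.diagonal_mul_mul_diagonal_mem hn had

end Fin

/-- Theorem 3(c): a symmetric unidiagonal `(n+1)×(n+1)` matrix `A` lies in the closure of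
the set `Y_{n+1}` of angle Gram matrices of hyperbolic `n`-simplexes iff either `A` is in
the closure of the set of Euclidean angle Gram matrices (i.e. is the Gram matrix of unit
vectors in `ℝ^n` admitting a nonzero nonnegative dependence), or `det A < 0`, `ad(A) ≥ 0`
and all principal `n×n` submatrices of `A` are positive semi-definite. -/
theorem mem_closure_hyperbolic_gram_iff
    (n : ℕ) (hn : 1 ≤ n) (A : Matrix (Fin (n + 1)) (Fin (n + 1)) ℝ)
    (hsymm : A.IsSymm) (hdiag : ∀ i, A i i = 1) :
    A ∈ closure {M : Matrix (Fin (n + 1)) (Fin (n + 1)) ℝ |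
        M.IsSymm ∧ (∀ i, M i i = 1) ∧ M.det < 0 ∧
        (∀ i j, 0 < M.adjugate i j) ∧
        ∀ i : Fin (n + 1), (M.submatrix i.succAbove i.succAbove).PosDef} ↔
      ((∃ v : Fin (n + 1) → EuclideanSpace ℝ (Fin n),
          (∀ i, ‖v i‖ = 1) ∧
          (∃ a : Fin (n + 1) → ℝ, a ≠ 0 ∧ (∀ i, 0 ≤ a i) ∧ ∑ i, a i • v i = 0) ∧
          A = Matrix.of (fun i j => ⟪v i, v j⟫)) ∨
        (A.det < 0 ∧ (∀ i j, 0 ≤ A.adjugate i j) ∧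
          ∀ i : Fin (n + 1), (A.submatrix i.succAbove i.succAbove).PosSemidef)) := by
  change A ∈ closure (hyperbolicGram n) ↔ _
  have : Nontrivial (Fin (n + 1)) := Fin.nontrivial_iff_two_le.2 (by omega)
  constructor
  · intro h
    obtain ⟨hd, had, hp, b, hb, hAb⟩ := hyperbolicGram_closure_subset h
    have hpsd : ∀ i : Fin (n + 1), (A.submatrix i.succAbove i.succAbove).PosSemidef := fun i =>
      .of_dotProduct_mulVec_nonneg (by simpa [IsHermitian, IsSymm] using hsymm.submatrix i.succAbove)
        fun x => by simpa using hp i x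
    rcases hd.lt_or_eq with hlt | hzero
    · exact Or.inr ⟨hlt, had, hpsd⟩
    · have hA := posSemidef_of_det_eq_zero hsymm hzero hpsd
      obtain ⟨v, hv⟩ := hA.exists_eq_gram hzero
      refine Or.inl ⟨v, fun i => ?_, ⟨b, ?_, hb.1, ?_⟩, hv⟩
      · have := hdiag i
        rw [hv, gram_apply, real_inner_self_eq_norm_sq] at this
        exact (pow_eq_one_iff_of_nonneg (norm_nonneg _) two_ne_zero).1 this
      · rintro rfl
        simpa using hb.2
      · have h0 := star_dotProduct_gram_mulVec (𝕜 := ℝ) v b b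
        rw [← hv, star_trivial] at h0
        rw [h0] at hAb
        exact real_inner_self_nonpos.1 hAb
  · intro h
    refine mem_closure_hyperbolicGram_of_isLorentzian hn hdiag ?_
    rcases h with ⟨v, -, ⟨a, ha0, ha, hav⟩, hv⟩ | ⟨hd, had, hp⟩
    · change A = gram ℝ v at hv
      have hA : A.PosSemidef := hv ▸ posSemidef_gram ℝ v
      refine hA.mem_closure_isLorentzian ha0 ha ((hA.dotProduct_mulVec_zero_iff a).1 ?_)
      rw [hv, star_dotProduct_gram_mulVec, hav, inner_zero_left]
    · refine IsLorentzian.mem_closure ⟨hsymm, hd, Pi.single 0 1, fun y hy => ?_⟩ had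
      rw [dotProduct_mulVec_eq_submatrix_succAbove A (i := 0) (by simpa using hy)]
      simpa using (hp 0).dotProduct_mulVec_nonneg (y ∘ Fin.succAbove 0)
end

section
/- Let n ≥ 1. Let Y_{n+1} be the set of (n+1)×(n+1) real symmetric matrices A with all diagonal entries equal to 1 such that det(A) < 0, every entry of the adjugate ad(A) is positive, and all principal n×n submatrices of A are positive definite. If A lies in the closure of Y_{n+1} in the space of (n+1)×(n+1) real matrices and det(A) = 0, then A is of the form [v_i·v_j]_{1≤i,j≤n+1} for some unit vectors v_1, ..., v_{n+1} in R^n such that ∑_{i=1}^{n+1} a_i v_i = 0 has a nonzero solution with all a_i ≥ 0. -/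
open RealInnerProductSpace

open Matrix

/-- A symmetric singular matrix whose quadratic form is nonnegative on every coordinate
hyperplane is positive semidefinite. -/
theorem posSemidef_of_det_eq_zero_of_nonneg_on_coordinate_hyperplanes
    {ι : Type*} [Fintype ι] [DecidableEq ι] {A : Matrix ι ι ℝ} (hsymm : A.IsSymm)
    (hdet : A.det = 0) (hface : ∀ i x, x i = 0 → 0 ≤ x ⬝ᵥ A *ᵥ x) : A.PosSemidef := by
  obtain ⟨w, hw, hAw⟩ := exists_mulVec_eq_zero_iff.2 hdet
  obtain ⟨i, hi⟩ := Function.ne_iff.1 hw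
  have hi' : w i ≠ 0 := hi
  have hwA : w ᵥ* A = 0 := by rw [← mulVec_transpose, hsymm.eq, hAw]
  refine .of_dotProduct_mulVec_nonneg (by simpa [IsHermitian] using hsymm.eq) fun x ↦ ?_
  have h := hface i (x - (x i / w i) • w) (by simp [hi'])
  simpa [mulVec_sub, mulVec_smul, hAw, sub_dotProduct, dotProduct_mulVec w, hwA] using h

/-- If the principal submatrix of `M` omitting `i` is positive semidefinite, then the quadratic
form of `M` is nonnegative on the hyperplane `x i = 0`. -/
theorem dotProduct_mulVec_nonneg_of_posSemidef_submatrix_succAbove {n : ℕ}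
    {M : Matrix (Fin (n + 1)) (Fin (n + 1)) ℝ} {i : Fin (n + 1)}
    (h : (M.submatrix i.succAbove i.succAbove).PosSemidef) {x : Fin (n + 1) → ℝ}
    (hx : x i = 0) : 0 ≤ x ⬝ᵥ M *ᵥ x := by
  have := h.dotProduct_mulVec_nonneg (x ∘ i.succAbove)
  simpa [dotProduct, mulVec, Fin.sum_univ_succAbove _ i, hx] using this

/-- A matrix with negative determinant and positive adjugate has a point of the standard simplex
at which its quadratic form is nonpositive. -/
theorem exists_mem_stdSimplex_dotProduct_mulVec_nonpos
    {ι : Type*} [Fintype ι] [DecidableEq ι] [Nonempty ι] {M : Matrix ι ι ℝ}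
    (hdet : M.det < 0) (hadj : ∀ i j, 0 < M.adjugate i j) :
    ∃ a ∈ stdSimplex ℝ ι, a ⬝ᵥ M *ᵥ a ≤ 0 := by
  obtain ⟨j⟩ := ‹Nonempty ι›
  set c : ι → ℝ := fun i ↦ M.adjugate i j with hc
  have hs : 0 < ∑ i, c i := Finset.sum_pos (fun i _ ↦ hadj i j) ⟨j, Finset.mem_univ j⟩
  have hMc : M *ᵥ c = Pi.single j M.det := by
    ext i
    have := congrFun (congrFun M.mul_adjugate i) j
    simpa [mul_apply, one_apply, Pi.single_apply, mulVec, dotProduct, hc] using this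
  refine ⟨(∑ i, c i)⁻¹ • c, ⟨fun i ↦ mul_nonneg (inv_nonneg.2 hs.le) (hadj i j).le, ?_⟩, ?_⟩
  · simp [← Finset.mul_sum, hs.ne']
  · have h : c j * M.det ≤ 0 := mul_nonpos_of_nonneg_of_nonpos (hadj j j).le hdet.le
    simp only [mulVec_smul, hMc, dotProduct_smul, dotProduct_single, smul_eq_mul, Pi.smul_apply,
      mul_assoc]
    have := inv_nonneg.2 hs.le
    exact mul_nonpos_of_nonneg_of_nonpos this (mul_nonpos_of_nonneg_of_nonpos this h)

theorem isClosed_setOf_exists_mem_stdSimplex_dotProduct_mulVec_nonpos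
    (ι : Type*) [Fintype ι] :
    IsClosed {M : Matrix ι ι ℝ | ∃ a ∈ stdSimplex ℝ ι, a ⬝ᵥ M *ᵥ a ≤ 0} := by
  have hclosed : IsClosed {p : Matrix ι ι ℝ × stdSimplex ℝ ι |
      (p.2 : ι → ℝ) ⬝ᵥ p.1 *ᵥ (p.2 : ι → ℝ) ≤ 0} :=
    isClosed_le (by fun_prop) continuous_const
  convert isClosedMap_fst_of_compactSpace _ hclosed using 1
  ext M
  simp only [Set.mem_ofPred_eq, Set.mem_image, Prod.exists, Subtype.exists, exists_and_right,
    exists_eq_right]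
  exact ⟨fun ⟨a, ha, h⟩ ↦ ⟨a, ha, h⟩, fun ⟨a, ha, h⟩ ↦ ⟨a, ha, h⟩⟩

open scoped MatrixOrder Matrix.Norms.L2Operator in
/-- A singular positive semidefinite real matrix of size `n + 1` is the Gram matrix of vectors
in `ℝ^n`. -/
theorem exists_eq_inner_of_posSemidef_of_det_eq_zero {n : ℕ}
    {A : Matrix (Fin (n + 1)) (Fin (n + 1)) ℝ} (hA : A.PosSemidef) (hdet : A.det = 0) :
    ∃ v : Fin (n + 1) → EuclideanSpace ℝ (Fin n), ∀ i j, A i j = ⟪v i, v j⟫ := by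
  obtain ⟨B, rfl⟩ := CStarAlgebra.nonneg_iff_eq_star_mul_self.1 hA.nonneg
  have hB : B.det = 0 := by simpa [star_eq_conjTranspose] using hdet
  obtain ⟨w, hw, hwB⟩ := exists_vecMul_eq_zero_iff.2 hB
  let w' : EuclideanSpace ℝ (Fin (n + 1)) := WithLp.toLp 2 w
  have hw' : w' ≠ 0 := by simpa [w'] using hw
  let u : Fin (n + 1) → EuclideanSpace ℝ (Fin (n + 1)) := fun i ↦ WithLp.toLp 2 (B.col i)
  have hu (i) : u i ∈ (ℝ ∙ w')ᗮ := by
    rw [Submodule.mem_orthogonal_singleton_iff_inner_right]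
    have := congrFun hwB i
    simpa [vecMul, dotProduct, u, w', PiLp.inner_apply, mul_comm] using this
  have : Fact (Module.finrank ℝ (EuclideanSpace ℝ (Fin (n + 1))) = n + 1) := ⟨by simp⟩
  let e := (OrthonormalBasis.fromOrthogonalSpanSingleton (𝕜 := ℝ) n hw').repr
  refine ⟨fun i ↦ e ⟨u i, hu i⟩, fun i j ↦ ?_⟩
  rw [LinearIsometryEquiv.inner_map_map, Submodule.coe_inner]
  simp [mul_apply, u, PiLp.inner_apply, mul_comm]

/-- Lemma 7: if `A` lies in the closure of the set `Y_{n+1}` of angle Gram matrices of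
hyperbolic `n`-simplexes and `det A = 0`, then `A` lies in the closure of the set of
Euclidean angle Gram matrices, i.e. `A` is the Gram matrix of unit vectors in `ℝ^n`
admitting a nonzero nonnegative linear dependence. -/
theorem mem_closure_hyperbolic_det_zero
    (n : ℕ) (hn : 1 ≤ n) (A : Matrix (Fin (n + 1)) (Fin (n + 1)) ℝ)
    (hA : A ∈ closure {M : Matrix (Fin (n + 1)) (Fin (n + 1)) ℝ |
        M.IsSymm ∧ (∀ i, M i i = 1) ∧ M.det < 0 ∧
        (∀ i j, 0 < M.adjugate i j) ∧
        ∀ i : Fin (n + 1), (M.submatrix i.succAbove i.succAbove).PosDef})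
    (hdet : A.det = 0) :
    ∃ v : Fin (n + 1) → EuclideanSpace ℝ (Fin n),
      (∀ i, ‖v i‖ = 1) ∧
      (∃ a : Fin (n + 1) → ℝ, a ≠ 0 ∧ (∀ i, 0 ≤ a i) ∧ ∑ i, a i • v i = 0) ∧
      A = Matrix.of (fun i j => ⟪v i, v j⟫) := by
  have hsymm : A.IsSymm :=
    closure_minimal (t := {M | Mᵀ = M}) (fun M hM ↦ hM.1)
      (isClosed_eq (by fun_prop) continuous_id) hA
  have hdiag (i) : A i i = 1 :=
    closure_minimal (t := {M : Matrix _ _ ℝ | M i i = 1}) (fun M hM ↦ hM.2.1 i)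
      (isClosed_eq (by fun_prop) continuous_const) hA
  have hface (i) (x : Fin (n + 1) → ℝ) (hx : x i = 0) : 0 ≤ x ⬝ᵥ A *ᵥ x :=
    closure_minimal (t := {M | 0 ≤ x ⬝ᵥ M *ᵥ x})
      (fun M hM ↦ dotProduct_mulVec_nonneg_of_posSemidef_submatrix_succAbove
        (hM.2.2.2.2 i).posSemidef hx)
      (isClosed_le continuous_const (by fun_prop)) hA
  obtain ⟨a, ha, haA⟩ : ∃ a ∈ stdSimplex ℝ (Fin (n + 1)), a ⬝ᵥ A *ᵥ a ≤ 0 :=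
    closure_minimal
      (fun M hM ↦ exists_mem_stdSimplex_dotProduct_mulVec_nonpos hM.2.2.1 hM.2.2.2.1)
      (isClosed_setOf_exists_mem_stdSimplex_dotProduct_mulVec_nonpos _) hA
  obtain ⟨v, hv⟩ := exists_eq_inner_of_posSemidef_of_det_eq_zero
    (posSemidef_of_det_eq_zero_of_nonneg_on_coordinate_hyperplanes hsymm hdet hface) hdet
  refine ⟨v, fun i ↦ ?_, ⟨a, ?_, ha.1, ?_⟩, by ext i j; exact hv i j⟩
  · have h := hv i i
    rw [hdiag, real_inner_self_eq_norm_sq] at h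
    exact (pow_eq_one_iff_of_nonneg (norm_nonneg _) two_ne_zero).1 h.symm
  · rintro rfl
    simpa using ha.2
  · rw [← real_inner_self_nonpos]
    convert haA
    simp only [sum_inner, inner_sum, real_inner_smul_left, real_inner_smul_right, dotProduct,
      mulVec, hv, Finset.mul_sum]
    simp only [mul_comm, real_inner_comm]
end

section
/- Let n ≥ 1 and let A be an (n+1)×(n+1) real symmetric matrix with all diagonal entries equal to 1 such that det(A) < 0, every entry of the adjugate ad(A) is nonnegative, and all principal n×n submatrices of A are positive semi-definite. Then A lies in the closure (in the space of (n+1)×(n+1) real matrices) of the set of (n+1)×(n+1) real symmetric matrices B with unit diagonal satisfying det(B) < 0, ad(B) entrywise positive, and all principal n×n submatrices of B positive definite. -/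
open Matrix Filter Topology

/-- If `det A < 0`, `ad(A) j j ≥ 0` and the principal submatrix
obtained by deleting row and column `i` is positive semi-definite, then an off-diagonal entry
`ad(A) i j` cannot vanish. -/
theorem Matrix.adjugate_apply_ne_zero_of_posSemidef_submatrix {n : ℕ}
    {A : Matrix (Fin (n + 1)) (Fin (n + 1)) ℝ} (hdet : A.det < 0) {i j : Fin (n + 1)}
    (hij : i ≠ j) (hjj : 0 ≤ A.adjugate j j)
    (hi : (A.submatrix i.succAbove i.succAbove).PosSemidef) : A.adjugate i j ≠ 0 := by
  intro h0
  set w : Fin (n + 1) → ℝ := fun k => A.adjugate k j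
  have hAw (k : Fin (n + 1)) : ∑ l, A k l * w l = if k = j then A.det else 0 := by
    simpa [Matrix.mul_apply, Matrix.one_apply] using congrFun₂ (A.mul_adjugate) k j
  have hsub (k : Fin n) :
      (A.submatrix i.succAbove i.succAbove *ᵥ fun l => w (i.succAbove l)) k =
        if i.succAbove k = j then A.det else 0 := by
    rw [← hAw, Fin.sum_univ_succAbove _ i, show w i = 0 from h0]
    simp [Matrix.mulVec, dotProduct]
  obtain ⟨j', rfl⟩ := Fin.exists_succAbove_eq hij.symm
  have hquad : star (fun l => w (i.succAbove l)) ⬝ᵥ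
      (A.submatrix i.succAbove i.succAbove *ᵥ fun l => w (i.succAbove l)) =
        w (i.succAbove j') * A.det := by
    simp [dotProduct, hsub]
  have hzero := (hi.dotProduct_mulVec_zero_iff _).1 (le_antisymm
    (hquad.trans_le (mul_nonpos_of_nonneg_of_nonpos hjj hdet.le)) (hi.dotProduct_mulVec_nonneg _))
  have := congrFun hzero j'
  rw [hsub] at this
  simp [hdet.ne] at this

/-- A diagonal entry of the adjugate is positive when the complementary principal submatrix is
positive definite. -/
theorem Matrix.adjugate_apply_self_pos_of_posDef_submatrix {n : ℕ}
    {A : Matrix (Fin (n + 1)) (Fin (n + 1)) ℝ} {i : Fin (n + 1)}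
    (hi : (A.submatrix i.succAbove i.succAbove).PosDef) : 0 < A.adjugate i i := by
  rw [adjugate_fin_succ_eq_det_submatrix, Even.neg_one_pow ⟨_, rfl⟩, one_mul]
  exact hi.det_pos


/-- Sufficiency in the second case of the proof of Theorem 3(c): if `A` is a symmetric
unidiagonal `(n+1)×(n+1)` matrix with `det A < 0`, `ad(A) ≥ 0` entrywise and all principal
`n×n` submatrices positive semi-definite, then `A` is a limit of angle Gram matrices of
hyperbolic `n`-simplexes. -/
theorem mem_closure_hyperbolic_of_neg_det
    (n : ℕ) (hn : 1 ≤ n) (A : Matrix (Fin (n + 1)) (Fin (n + 1)) ℝ)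
    (hsymm : A.IsSymm) (hdiag : ∀ i, A i i = 1) (hdet : A.det < 0)
    (had : ∀ i j, 0 ≤ A.adjugate i j)
    (hprin : ∀ i : Fin (n + 1), (A.submatrix i.succAbove i.succAbove).PosSemidef) :
    A ∈ closure {M : Matrix (Fin (n + 1)) (Fin (n + 1)) ℝ |
        M.IsSymm ∧ (∀ i, M i i = 1) ∧ M.det < 0 ∧
        (∀ i j, 0 < M.adjugate i j) ∧
        ∀ i : Fin (n + 1), (M.submatrix i.succAbove i.succAbove).PosDef} := by
  set B : ℝ → Matrix (Fin (n + 1)) (Fin (n + 1)) ℝ := fun t => (1 - t) • A + t • 1 with hB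
  have hcont : Continuous B := by fun_prop
  have hB0 : B 0 = A := by simp [hB]
  have htend : Tendsto B (𝓝[>] 0) (𝓝 A) := by
    simpa only [hB0] using (hcont.tendsto 0).mono_left nhdsWithin_le_nhds
  refine mem_closure_of_tendsto htend ?_
  have hdet' : ∀ᶠ t in 𝓝[>] 0, (B t).det < 0 :=
    ((continuous_id.matrix_det.tendsto A).comp htend).eventually_lt_const hdet
  have hoff : ∀ᶠ t in 𝓝[>] 0, ∀ i j, i ≠ j → 0 < (B t).adjugate i j := by
    refine eventually_all.2 fun i => eventually_all.2 fun j => ?_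
    by_cases hij : i = j
    · simp [hij]
    have hpos : 0 < A.adjugate i j := (had i j).lt_of_ne'
      (adjugate_apply_ne_zero_of_posSemidef_submatrix hdet hij (had j j) (hprin i))
    filter_upwards [(((continuous_id.matrix_adjugate.matrix_elem i j).tendsto A).comp
      htend).eventually_const_lt hpos] with t ht _ using ht
  filter_upwards [hdet', hoff, Ioo_mem_nhdsGT (zero_lt_one' ℝ)] with t htdet htoff ⟨ht0, ht1⟩
  have hpd (i : Fin (n + 1)) : ((B t).submatrix i.succAbove i.succAbove).PosDef := by
    have hsplit : (B t).submatrix i.succAbove i.succAbove =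
        (1 - t) • A.submatrix i.succAbove i.succAbove + t • 1 := by
      rw [← submatrix_one _ i.succAbove_right_injective]
      rfl
    rw [hsplit]
    exact PosDef.posSemidef_add ((hprin i).smul (sub_nonneg.2 ht1.le)) (PosDef.one.smul ht0)
  refine ⟨(hsymm.smul _).add (isSymm_one.smul _), fun i => by simp [hB, hdiag], htdet,
    fun i j => ?_, hpd⟩
  obtain rfl | hij := eq_or_ne i j
  · exact adjugate_apply_self_pos_of_posDef_submatrix (hpd i)
  · exact htoff i j hij
end

section
/- Let k ≥ 1 and let B be a (k+1)×(k+1) real symmetric positive semi-definite matrix of rank k such that the kernel of B contains a vector (a_1, ..., a_{k+1}) with a_i > 0 for all i. Then every entry of the adjugate ad(B) is nonnegative and ad(B) ≠ 0. -/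
open Matrix

/-- If a square matrix of size `k + 1` has rank `k`, its kernel is spanned by any nonzero
vector in it. -/
theorem Matrix.exists_eq_smul_of_mulVec_eq_zero_of_rank_eq {K : Type*} [Field K] {k : ℕ}
    {B : Matrix (Fin (k + 1)) (Fin (k + 1)) K} (hrank : B.rank = k)
    {a x : Fin (k + 1) → K} (ha : a ≠ 0) (hker : B *ᵥ a = 0) (hx : B *ᵥ x = 0) :
    ∃ c : K, x = c • a := by
  have hdim : Module.finrank K (LinearMap.ker B.mulVecLin) = 1 := by
    have h := LinearMap.finrank_range_add_finrank_ker B.mulVecLin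
    rw [← Matrix.rank, hrank, Module.finrank_fin_fun] at h
    omega
  have hne : (⟨a, hker⟩ : LinearMap.ker B.mulVecLin) ≠ 0 := fun h => ha (congrArg Subtype.val h)
  obtain ⟨c, hc⟩ := (finrank_eq_one_iff_of_nonzero' _ hne).1 hdim ⟨x, hx⟩
  exact ⟨c, (congrArg Subtype.val hc).symm⟩

theorem Matrix.submatrix_succAbove_mulVec {R : Type*} [NonUnitalNonAssocSemiring R] {k : ℕ}
    (B : Matrix (Fin (k + 1)) (Fin (k + 1)) R) (i : Fin (k + 1)) (x : Fin k → R) (j : Fin k) :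
    (B.submatrix i.succAbove i.succAbove *ᵥ x) j =
      (B *ᵥ (i.insertNth 0 x : Fin (k + 1) → R)) (i.succAbove j) := by
  simp [mulVec, dotProduct, Fin.sum_univ_succAbove _ i]

/-- If a positive semidefinite matrix of size `k + 1` and rank `k` has a kernel vector with
nonzero `i`-th coordinate, then the `i`-th principal cofactor is positive. -/
theorem Matrix.PosSemidef.adjugate_diag_pos_of_rank_eq {k : ℕ}
    {B : Matrix (Fin (k + 1)) (Fin (k + 1)) ℝ} (hB : B.PosSemidef) (hrank : B.rank = k)
    {a : Fin (k + 1) → ℝ} (hker : B *ᵥ a = 0) {i : Fin (k + 1)} (hai : a i ≠ 0) :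
    0 < B.adjugate i i := by
  have ha : a ≠ 0 := fun h => hai (congrFun h i)
  rw [adjugate_fin_succ_eq_det_submatrix, Even.neg_one_pow ⟨_, rfl⟩, one_mul]
  refine lt_of_le_of_ne (hB.submatrix i.succAbove).det_nonneg (Ne.symm fun hdet => ?_)
  obtain ⟨x, hx0, hx⟩ := exists_mulVec_eq_zero_iff.2 hdet
  set y : Fin (k + 1) → ℝ := i.insertNth 0 x with hy
  have hBy : B *ᵥ y = 0 := by
    refine (hB.dotProduct_mulVec_zero_iff y).1 ?_
    rw [dotProduct, Fin.sum_univ_succAbove _ i]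
    simp [hy, ← submatrix_succAbove_mulVec, hx]
  obtain ⟨c, hc⟩ := exists_eq_smul_of_mulVec_eq_zero_of_rank_eq hrank ha hker hBy
  have hc0 : c = 0 := by
    have h := congrFun hc i
    simpa [hy, hai] using h
  refine hx0 (funext fun j => ?_)
  have h := congrFun hc (i.succAbove j)
  simpa [hy, hc0] using h

/-- From the proof of Theorem 3(a): if `B` is a `(k+1)×(k+1)` positive semi-definite
symmetric matrix of rank `k` whose kernel contains a strictly positive vector, then every
entry of the adjugate `ad(B)` is nonnegative and `ad(B) ≠ 0`. -/
theorem adjugate_nonneg_of_posSemidef_rank_kernel_pos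
    (k : ℕ) (hk : 1 ≤ k) (B : Matrix (Fin (k + 1)) (Fin (k + 1)) ℝ)
    (hB : B.PosSemidef) (hrank : B.rank = k)
    (a : Fin (k + 1) → ℝ) (ha : ∀ i, 0 < a i) (hker : B.mulVec a = 0) :
    (∀ i j, 0 ≤ B.adjugate i j) ∧ B.adjugate ≠ 0 := by
  have hne : a ≠ 0 := fun h => (ha 0).ne' (congrFun h 0)
  have hdiag (i) : 0 < B.adjugate i i := hB.adjugate_diag_pos_of_rank_eq hrank hker (ha i).ne'
  refine ⟨fun i j => ?_, fun h => (hdiag 0).ne' (by rw [h, Matrix.zero_apply])⟩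
  have hdet : B.det = 0 := exists_mulVec_eq_zero_iff.1 ⟨a, hne, hker⟩
  have hcol : B *ᵥ (B.adjugate.col j) = 0 := by
    ext l
    have h := congrFun (congrFun B.mul_adjugate l) j
    rwa [hdet, zero_smul] at h
  obtain ⟨c, hc⟩ := exists_eq_smul_of_mulVec_eq_zero_of_rank_eq hrank hne hker hcol
  have hentry (l) : B.adjugate l j = c * a l := congrFun hc l
  have hcpos : 0 < c := pos_of_mul_pos_left (hentry j ▸ hdiag j) (ha j).le
  rw [hentry]
  exact (mul_pos hcpos (ha i)).le
end

section
/- Let n ≥ 1 and let v_1, ..., v_{n+1} be vectors in R^n such that the linear system ∑_{i=1}^{n+1} a_i v_i = 0 has a nonzero solution with all a_i ≥ 0. Let (a_1, ..., a_{n+1}) be such a nonzero nonnegative solution having the least number of nonzero entries among all nonzero nonnegative solutions, and let S = {i : a_i > 0}, with |S| = k+1. Then the vectors {v_i : i ∈ S} span a subspace of dimension exactly k; that is, the rank of the matrix whose columns are the vectors v_i for i ∈ S equals |S| − 1. -/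
/-- Moving from a nonnegative `a` in the direction `-c` stays in the nonnegative orthant until
some coordinate with `0 < c j` vanishes. -/
lemma exists_sub_mul_nonneg_and_eq_zero {ι : Type*} [Fintype ι] {a c : ι → ℝ}
    (ha : ∀ i, 0 ≤ a i) (hc : ∃ i, 0 < c i) :
    ∃ t j, 0 < c j ∧ (∀ i, 0 ≤ a i - t * c i) ∧ a j - t * c j = 0 := by
  obtain ⟨i, hi⟩ := hc
  obtain ⟨j, hj, hmin⟩ := (Finset.univ.filter fun i => 0 < c i).exists_min_image
    (fun i => a i / c i) ⟨i, by simpa using hi⟩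
  simp only [Finset.mem_filter, Finset.mem_univ, true_and] at hj hmin
  refine ⟨a j / c j, j, hj, fun l => ?_, by field_simp; simp⟩
  rcases le_or_gt (c l) 0 with hl | hl
  · linarith [mul_nonpos_of_nonneg_of_nonpos (div_nonneg (ha j) hj.le) hl, ha l]
  · linarith [(le_div_iff₀ hl).1 (hmin l hl)]

section MinimalSupport

variable {ι E : Type*} [Fintype ι] [AddCommGroup E] [Module ℝ E] {v : ι → E} {a : ι → ℝ}

/-- A linear dependence supported in the support of a minimal nonnegative one, and vanishing
somewhere on that support, has no positive entry. -/
lemma nonpos_of_minimal_support_dependence (hann : ∀ i, 0 ≤ a i)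
    (hdep : ∑ i, a i • v i = 0)
    (hmin : ∀ b : ι → ℝ, b ≠ 0 → (∀ i, 0 ≤ b i) → ∑ i, b i • v i = 0 →
      (Finset.univ.filter fun i => 0 < a i).card ≤ (Finset.univ.filter fun i => 0 < b i).card)
    {c : ι → ℝ} (hc : ∑ i, c i • v i = 0) (hsupp : ∀ i, a i = 0 → c i = 0)
    {p : ι} (hp : 0 < a p) (hcp : c p = 0) (i : ι) : c i ≤ 0 := by
  by_contra! hi
  obtain ⟨t, j, hj, hnn, hzero⟩ := exists_sub_mul_nonneg_and_eq_zero hann ⟨i, hi⟩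
  have hle := hmin (fun i => a i - t * c i)
    (fun h => hp.ne' (by simpa [hcp] using congrFun h p)) hnn
    (by simp [sub_smul, mul_smul, Finset.sum_sub_distrib, ← Finset.smul_sum, hdep, hc])
  refine hle.not_gt (Finset.card_lt_card (Finset.ssubset_iff_of_subset ?_ |>.2 ⟨j, ?_, ?_⟩))
  · intro l hl
    simp only [Finset.mem_filter, Finset.mem_univ, true_and] at hl ⊢
    refine (hann l).lt_of_ne' fun h => ?_
    simp [h, hsupp l h] at hl
  · simpa using (hann j).lt_of_ne' fun h => hj.ne' (hsupp j h)
  · simpa using sub_nonpos.1 hzero.le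

/-- Removing one vector from a minimal nonnegative dependence leaves an independent family. -/
lemma linearIndepOn_erase_of_minimal_support_dependence [DecidableEq ι] (hann : ∀ i, 0 ≤ a i)
    (hdep : ∑ i, a i • v i = 0)
    (hmin : ∀ b : ι → ℝ, b ≠ 0 → (∀ i, 0 ≤ b i) → ∑ i, b i • v i = 0 →
      (Finset.univ.filter fun i => 0 < a i).card ≤ (Finset.univ.filter fun i => 0 < b i).card)
    {p : ι} (hp : 0 < a p) :
    LinearIndepOn ℝ v ((Finset.univ.filter fun i => 0 < a i).erase p : Finset ι) := by
  rw [linearIndepOn_finset_iff]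
  intro f hf i hi
  set T := (Finset.univ.filter fun i => 0 < a i).erase p with hT
  let c : ι → ℝ := fun i => if i ∈ T then f i else 0
  have hc : ∑ i, c i • v i = 0 := by
    simpa [c, ite_smul, Finset.sum_ite_mem] using hf
  have hsupp : ∀ i, a i = 0 → c i = 0 := fun i h => by simp [c, hT, h]
  have hcp : c p = 0 := by simp [c, hT]
  have hpos := nonpos_of_minimal_support_dependence hann hdep hmin hc hsupp hp hcp i
  have hneg := nonpos_of_minimal_support_dependence hann hdep hmin (c := -c)
    (by simp [hc]) (fun i h => by simp [hsupp i h]) hp (by simp [hcp]) i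
  simp only [c, Pi.neg_apply, if_pos hi] at hpos hneg
  linarith

/-- A vector with positive coefficient in a nonnegative dependence lies in the span of the other
vectors in the support. -/
lemma mem_span_erase_of_dependence [DecidableEq ι] (hann : ∀ i, 0 ≤ a i)
    (hdep : ∑ i, a i • v i = 0) {p : ι} (hp : 0 < a p) :
    v p ∈ Submodule.span ℝ
      (v '' ((Finset.univ.filter fun i => 0 < a i).erase p : Finset ι)) := by
  rw [← Submodule.smul_mem_iff _ hp.ne']
  rw [← Finset.add_sum_erase _ _ (Finset.mem_univ p)] at hdep
  rw [eq_neg_of_add_eq_zero_left hdep]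
  refine neg_mem (Submodule.sum_mem _ fun i hi => ?_)
  rcases (hann i).eq_or_lt with h | h
  · simp [← h]
  · exact Submodule.smul_mem _ _ (Submodule.subset_span
      ⟨i, by simpa [h] using Finset.ne_of_mem_erase hi, rfl⟩)

end MinimalSupport

/-- The minimal-support lemma from the proof of Theorem 3(a): if a nonzero nonnegative
solution `a` of `∑ aᵢ vᵢ = 0` has the least number of nonzero entries among all such
solutions and its support `S = {i | aᵢ > 0}` has `k+1` elements, then the vectors
`{vᵢ : i ∈ S}` span a subspace of dimension exactly `k`. -/
theorem span_dim_of_minimal_support_dependence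
    (n k : ℕ) (hn : 1 ≤ n) (v : Fin (n + 1) → EuclideanSpace ℝ (Fin n))
    (a : Fin (n + 1) → ℝ) (ha0 : a ≠ 0) (hann : ∀ i, 0 ≤ a i)
    (hdep : ∑ i, a i • v i = 0)
    (hmin : ∀ b : Fin (n + 1) → ℝ, b ≠ 0 → (∀ i, 0 ≤ b i) → ∑ i, b i • v i = 0 →
      (Finset.univ.filter fun i => 0 < a i).card ≤
        (Finset.univ.filter fun i => 0 < b i).card)
    (hcard : (Finset.univ.filter fun i => 0 < a i).card = k + 1) :
    Module.finrank ℝ (Submodule.span ℝ (v '' {i | 0 < a i})) = k := by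
  obtain ⟨p, hp⟩ : (Finset.univ.filter fun i => 0 < a i).Nonempty :=
    Finset.card_pos.1 (by omega)
  have hpa : 0 < a p := by simpa using hp
  have hspan := mem_span_erase_of_dependence hann hdep hpa
  have hind := linearIndepOn_erase_of_minimal_support_dependence hann hdep hmin hpa
  have hset : {i | 0 < a i} =
      insert p (((Finset.univ.filter fun i => 0 < a i).erase p : Finset _) : Set _) := by
    rw [← Finset.coe_insert, Finset.insert_erase hp]
    simp
  rw [hset, Set.image_insert_eq, Submodule.span_insert_eq_span hspan, Set.image_eq_range]
  refine (finrank_span_eq_card hind.linearIndependent).trans ?_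
  exact (Fintype.card_coe _).trans (by simp [Finset.card_erase_of_mem hp, hcard])
end

section
/- Let n ≥ 1, let v_1, ..., v_{n+1} be unit vectors in R^n, and let A = [v_i·v_j]_{1≤i,j≤n+1} be their Gram matrix. Then the following are equivalent: (i) every n of the vectors v_1, ..., v_{n+1} are linearly independent and ∑_{i=1}^{n+1} a_i v_i = 0 has a solution with all a_i > 0; (ii) det(A) = 0, every entry of the adjugate ad(A) is positive, and all principal n×n submatrices of A are positive definite. -/
open RealInnerProductSpace

/-- The kernel of a Gram matrix consists of the linear dependences of its vectors. -/
theorem gram_mulVec_eq_zero_iff {ι E : Type*} [Fintype ι] [NormedAddCommGroup E]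
    [InnerProductSpace ℝ E] (v : ι → E) (x : ι → ℝ) :
    (Matrix.gram ℝ v).mulVec x = 0 ↔ ∑ i, x i • v i = 0 := by
  constructor
  · intro h
    rw [← inner_self_eq_zero (𝕜 := ℝ), ← Matrix.star_dotProduct_gram_mulVec, h,
      dotProduct_zero]
  · intro h
    ext i
    have hi : (Matrix.gram ℝ v).mulVec x i = ⟪v i, ∑ j, x j • v j⟫ := by
      simp [Matrix.mulVec, dotProduct, inner_sum, inner_smul_right, mul_comm]
    rw [hi, h, inner_zero_right, Pi.zero_apply]

/-- If the determinant of a Gram matrix vanishes, each column of its adjugate is a linear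
dependence of the vectors. -/
theorem sum_adjugate_gram_smul_eq_zero {ι E : Type*} [Fintype ι] [DecidableEq ι]
    [NormedAddCommGroup E] [InnerProductSpace ℝ E] (v : ι → E)
    (hdet : (Matrix.gram ℝ v).det = 0) (j : ι) :
    ∑ i, (Matrix.gram ℝ v).adjugate i j • v i = 0 := by
  rw [← gram_mulVec_eq_zero_iff v fun i => (Matrix.gram ℝ v).adjugate i j]
  ext i
  have h := congrFun (congrFun (Matrix.mul_adjugate (Matrix.gram ℝ v)) i) j
  simpa [hdet, Matrix.mul_apply, Matrix.mulVec, dotProduct] using h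

/-- A linear dependence with a vanishing coefficient is trivial if the remaining vectors are
linearly independent. -/
theorem eq_zero_of_sum_smul_eq_zero_of_succAbove {K E : Type*} [Ring K] [AddCommGroup E]
    [Module K E] {n : ℕ} {v : Fin (n + 1) → E} {j : Fin (n + 1)}
    (hv : LinearIndependent K fun k : Fin n => v (j.succAbove k)) {c : Fin (n + 1) → K}
    (hc : ∑ i, c i • v i = 0) (hj : c j = 0) : c = 0 := by
  rw [Fin.sum_univ_succAbove _ j, hj, zero_smul, zero_add] at hc
  have h := Fintype.linearIndependent_iff.mp hv _ hc
  ext i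
  exact Fin.succAboveCases j hj h i

/-- Proposition 2(a): for unit vectors `v 1, ..., v (n+1)` in `ℝ^n` with Gram matrix `A`,
the tuple satisfies the Euclidean simplex normal-vector condition (4.2) (every `n` vectors
linearly independent and a strictly positive dependence exists) iff `det A = 0`,
`ad(A) > 0` entrywise, and all principal `n×n` submatrices of `A` are positive definite. -/
theorem euclidean_gram_characterization
    (n : ℕ) (hn : 1 ≤ n) (v : Fin (n + 1) → EuclideanSpace ℝ (Fin n))
    (hunit : ∀ i, ‖v i‖ = 1)
    (A : Matrix (Fin (n + 1)) (Fin (n + 1)) ℝ)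
    (hA : A = Matrix.of (fun i j => ⟪v i, v j⟫)) :
    ((∀ i : Fin (n + 1), LinearIndependent ℝ (fun j : Fin n => v (i.succAbove j))) ∧
        ∃ a : Fin (n + 1) → ℝ, (∀ i, 0 < a i) ∧ ∑ i, a i • v i = 0) ↔
      (A.det = 0 ∧ (∀ i j, 0 < A.adjugate i j) ∧
        ∀ i : Fin (n + 1), (A.submatrix i.succAbove i.succAbove).PosDef) := by
  replace hA : A = Matrix.gram ℝ v := hA
  subst hA
  have hpos (i : Fin (n + 1)) :
      ((Matrix.gram ℝ v).submatrix i.succAbove i.succAbove).PosDef ↔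
        LinearIndependent ℝ (fun j : Fin n => v (i.succAbove j)) :=
    Matrix.posDef_gram_iff_linearIndependent (v := fun j : Fin n => v (i.succAbove j))
  simp_rw [hpos]
  constructor
  · rintro ⟨hli, a, ha, hsum⟩
    have hdet : (Matrix.gram ℝ v).det = 0 :=
      Matrix.exists_mulVec_eq_zero_iff.mp
        ⟨a, fun h => (ha 0).ne' (congrFun h 0), (gram_mulVec_eq_zero_iff v a).mpr hsum⟩
    refine ⟨hdet, fun i j => ?_, hli⟩
    set c : Fin (n + 1) → ℝ := fun k => (Matrix.gram ℝ v).adjugate k j with hc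
    have hcj : 0 < c j := by
      rw [hc]
      simp only [Matrix.adjugate_fin_succ_eq_det_submatrix, Even.neg_pow ⟨(j : ℕ), rfl⟩,
        one_pow, one_mul]
      exact ((hpos j).mpr (hli j)).det_pos
    have hdep : ∑ k, (c k - c j / a j * a k) • v k = 0 := by
      simp_rw [sub_smul, mul_smul, Finset.sum_sub_distrib, ← Finset.smul_sum, hsum]
      rw [sum_adjugate_gram_smul_eq_zero v hdet j, smul_zero, sub_zero]
    have hzero := congrFun (eq_zero_of_sum_smul_eq_zero_of_succAbove (hli j) hdep
      (by rw [div_mul_cancel₀ _ (ha j).ne', sub_self])) i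
    change 0 < c i
    rw [sub_eq_zero.mp hzero]
    exact mul_pos (div_pos hcj (ha j)) (ha i)
  · rintro ⟨hdet, hadj, hli⟩
    exact ⟨hli, fun i => (Matrix.gram ℝ v).adjugate i 0, fun i => hadj i 0,
      sum_adjugate_gram_smul_eq_zero v hdet 0⟩
end

section
/- Let n ≥ 0 and let v_1, ..., v_{n+1} be unit vectors in R^{n+1} that are not contained in any open half-space, i.e., there is no w ∈ R^{n+1} with w·v_i > 0 for all i = 1, ..., n+1. Then the closed convex cone {x ∈ R^{n+1} : v_i·x ≥ 0 for all i = 1, ..., n+1} has (n+1)-dimensional Lebesgue measure zero. -/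
open RealInnerProductSpace MeasureTheory

/-- The hyperplane orthogonal to a nonzero vector is null for every additive Haar measure. -/
theorem addHaar_setOf_inner_eq_zero {E : Type*} [NormedAddCommGroup E] [InnerProductSpace ℝ E]
    [FiniteDimensional ℝ E] [MeasurableSpace E] [BorelSpace E] (μ : Measure E)
    [μ.IsAddHaarMeasure] {v : E} (hv : v ≠ 0) : μ {x | ⟪v, x⟫ = 0} = 0 := by
  have hset : {x | ⟪v, x⟫ = 0} = ((ℝ ∙ v)ᗮ : Set E) := by
    ext x
    exact Submodule.mem_orthogonal_singleton_iff_inner_right.symm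
  rw [hset]
  refine Measure.addHaar_submodule μ _ fun htop ↦ hv ?_
  rwa [Submodule.orthogonal_eq_top_iff, Submodule.span_singleton_eq_bot] at htop

/-- The key measure-zero step in the spherical case of Theorem 1: if unit vectors
`v 1, ..., v (n+1)` in `ℝ^{n+1}` are not contained in any open half-space, then the closed
convex cone `{x | vᵢ·x ≥ 0 for all i}` has Lebesgue measure zero. -/
theorem cone_measure_zero_of_not_in_open_halfspace
    (n : ℕ) (v : Fin (n + 1) → EuclideanSpace ℝ (Fin (n + 1)))
    (hunit : ∀ i, ‖v i‖ = 1)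
    (h : ¬ ∃ w : EuclideanSpace ℝ (Fin (n + 1)), ∀ i, 0 < ⟪w, v i⟫) :
    volume {x : EuclideanSpace ℝ (Fin (n + 1)) | ∀ i, 0 ≤ ⟪v i, x⟫} = 0 := by
  have hnull : volume (⋃ i, {x | ⟪v i, x⟫ = 0}) = 0 :=
    measure_iUnion_null fun i ↦
      addHaar_setOf_inner_eq_zero volume (norm_ne_zero_iff.mp (by simp [hunit i]))
  refine measure_mono_null (fun x hx ↦ ?_) hnull
  push Not at h
  obtain ⟨i, hi⟩ := h x
  rw [real_inner_comm] at hi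
  exact Set.mem_iUnion.mpr ⟨i, le_antisymm hi (hx i)⟩
end
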